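/- arXiv:2109.12485 — 8 statements merged into one kernel-verified Lean document; each statement's English description precedes it below -/
import Mathlib

section
/- Let γ : [0,∞) → [0,∞) be measurable with γ(t) > 0 for 0 ≤ t < 1, γ(t) = 0 for t ≥ 1, and ∫_{B_1(0)} ξ_i² γ(‖ξ‖) dξ = 1 for i = 1,2, and set γ̃_δ(r) = δ^{-4} γ(r/δ). Let Ω ⊆ ℝ² be a nonempty bounded open set, let N ∈ ℕ, δ₀ > 0, and for each δ ∈ (0,δ₀] let Q_δ ⊆ B_δ(0) be a Borel set with Q_δ = -Q_δ that is contained in the convex hull of some finite set of at most N points of B_δ(0). Define the nonlocal operator L_δ u(x) = 2 ∫_{ℝ²} (u(y) - u(x)) γ̃_δ(‖y-x‖) 1_{Q_δ}(y-x) dy and let q(x) = ‖x‖². Then there exists ε > 0, depending only on N and γ, such that for every δ ∈ (0,δ₀] and every x ∈ Ω one has 4 - L_δ q(x) ≥ ε; in particular, L_δ q(x) does not converge to Δq(x) = 4 as δ → 0. -/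
open MeasureTheory Metric Filter Set Real
open scoped Topology Pointwise

noncomputable section

local notation "E" => EuclideanSpace ℝ (Fin 2)

/-- The plane contains arbitrarily many unit vectors. -/
lemma exists_injective_unit_vectors (n : ℕ) :
    ∃ u : Fin n → EuclideanSpace ℝ (Fin 2), Function.Injective u ∧ ∀ k, ‖u k‖ = 1 := by
  refine ⟨fun k => !₂[cos ((k : ℝ) + 1)⁻¹, sin ((k : ℝ) + 1)⁻¹], ?_, ?_⟩
  · intro j k hjk
    have hmem : ∀ i : Fin n, ((i : ℝ) + 1)⁻¹ ∈ Icc 0 π := fun i =>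
      ⟨by positivity, (inv_le_one_of_one_le₀ (by simp)).trans (by linarith [pi_gt_three])⟩
    have hcos : cos ((j : ℝ) + 1)⁻¹ = cos ((k : ℝ) + 1)⁻¹ := by
      simpa using congrArg (fun v : EuclideanSpace ℝ (Fin 2) => v 0) hjk
    have := injOn_cos (hmem j) (hmem k) hcos
    rw [inv_inj, add_left_inj, Nat.cast_inj] at this
    exact Fin.ext this
  · intro k
    simp [EuclideanSpace.norm_eq, Fin.sum_univ_two]

/-- Finitely many distinct unit vectors span pairwise disjoint caps of the unit ball at some
height below one. -/
lemma exists_cap_height {V ι : Type*} [NormedAddCommGroup V] [InnerProductSpace ℝ V] [Finite ι]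
    {u : ι → V} (hu : Function.Injective u) (hu1 : ∀ k, ‖u k‖ = 1) :
    ∃ h : ℝ, 0 < h ∧ h < 1 ∧
      ∀ j k ξ, ‖ξ‖ ≤ 1 → h < inner ℝ ξ (u j) → h < inner ℝ ξ (u k) → j = k := by
  have hlt : ∀ j k, j ≠ k → ‖u j + u k‖ / 2 < 1 := by
    intro j k hjk
    have h1 : inner ℝ (u j) (u k) < 1 :=
      (inner_lt_one_iff_real_of_norm_eq_one (hu1 j) (hu1 k)).2 (hu.ne hjk)
    have h2 := norm_add_sq_real (u j) (u k)
    rw [hu1, hu1] at h2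
    nlinarith [norm_nonneg (u j + u k)]
  have hev : ∀ᶠ h in 𝓝[<] (1 : ℝ), ∀ j k, j ≠ k → ‖u j + u k‖ / 2 < h := by
    simp only [eventually_all]
    exact fun j k hjk => eventually_nhdsWithin_of_eventually_nhds (lt_mem_nhds (hlt j k hjk))
  have hev0 : ∀ᶠ h in 𝓝[<] (1 : ℝ), 0 < h :=
    eventually_nhdsWithin_of_eventually_nhds (lt_mem_nhds one_pos)
  obtain ⟨h, hsep, h0, h1⟩ := (hev.and (hev0.and self_mem_nhdsWithin)).exists
  refine ⟨h, h0, h1, fun j k ξ hξ hj hk => by_contra fun hjk => ?_⟩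
  have hle := real_inner_le_norm ξ (u j + u k)
  rw [inner_add_right] at hle
  nlinarith [hsep j k hjk, norm_nonneg (u j + u k)]

/-- If more half-planes than points have pairwise disjoint traces on a set containing the points,
one of the half-planes contains no point. -/
lemma exists_forall_not_of_card_lt {α ι : Type*} [Fintype ι] (S : Finset α)
    (hS : S.card < Fintype.card ι) (p : ι → α → Prop)
    (hp : ∀ s ∈ S, ∀ j k, p j s → p k s → j = k) : ∃ k, ∀ s ∈ S, ¬ p k s := by
  by_contra! H
  choose f hfS hf using H
  obtain ⟨j, -, k, -, hjk, hfjk⟩ := Finset.exists_ne_map_eq_of_card_lt_of_maps_to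
    (s := Finset.univ) (t := S) (f := f) (by simpa using hS) (fun k _ => hfS k)
  exact hjk (hp _ (hfS j) j k (hf j) (hfjk ▸ hf k))

/-- The second moment of a radial kernel with unit coordinate second moments. -/
lemma integrable_and_integral_norm_sq_mul {γ : ℝ → ℝ} (hγsupp : ∀ t, 1 ≤ t → γ t = 0)
    (hγnorm : ∀ i : Fin 2, ∫ ξ in closedBall (0 : EuclideanSpace ℝ (Fin 2)) 1,
      (ξ i) ^ 2 * γ ‖ξ‖ = 1) :
    Integrable (fun ξ : EuclideanSpace ℝ (Fin 2) => ‖ξ‖ ^ 2 * γ ‖ξ‖) ∧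
      ∫ ξ : EuclideanSpace ℝ (Fin 2), ‖ξ‖ ^ 2 * γ ‖ξ‖ = 2 := by
  have hsupp : ∀ i : Fin 2, ∀ ξ : EuclideanSpace ℝ (Fin 2), ξ ∉ closedBall 0 1 →
      (ξ i) ^ 2 * γ ‖ξ‖ = 0 := by
    intro i ξ hξ
    rw [hγsupp _ (by simpa using (not_le.1 (by simpa using hξ) : 1 < ‖ξ‖).le), mul_zero]
  have hone : ∀ i : Fin 2, ∫ ξ : EuclideanSpace ℝ (Fin 2), (ξ i) ^ 2 * γ ‖ξ‖ = 1 := fun i => by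
    rw [← setIntegral_eq_integral_of_forall_compl_eq_zero (hsupp i), hγnorm]
  have hInt : ∀ i : Fin 2,
      Integrable fun ξ : EuclideanSpace ℝ (Fin 2) => (ξ i) ^ 2 * γ ‖ξ‖ := fun i =>
    .of_integral_ne_zero (by rw [hone]; exact one_ne_zero)
  have hsum : (fun ξ : EuclideanSpace ℝ (Fin 2) => ‖ξ‖ ^ 2 * γ ‖ξ‖) =
      fun ξ => (ξ 0) ^ 2 * γ ‖ξ‖ + (ξ 1) ^ 2 * γ ‖ξ‖ := by
    ext ξ
    rw [EuclideanSpace.real_norm_sq_eq, Fin.sum_univ_two, add_mul]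
  rw [hsum]
  refine ⟨(hInt 0).add (hInt 1), ?_⟩
  rw [integral_add (hInt 0) (hInt 1), hone, hone]
  norm_num

/-- A nonlocal difference of `‖·‖²` against an even nonnegative kernel is at most the second
moment of the kernel, because the first moment cancels (or the integral diverges). -/
lemma integral_norm_sq_sub_mul_le {V : Type*} [NormedAddCommGroup V] [InnerProductSpace ℝ V]
    [MeasurableSpace V] [BorelSpace V] {μ : Measure V} [μ.IsAddLeftInvariant]
    [μ.IsAddRightInvariant] [μ.IsNegInvariant] {w : V → ℝ} (hw : ∀ z, 0 ≤ w z)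
    (hwneg : ∀ z, w (-z) = w z) (x : V) :
    ∫ y, (‖y‖ ^ 2 - ‖x‖ ^ 2) * w (y - x) ∂μ ≤ ∫ z, ‖z‖ ^ 2 * w z ∂μ := by
  set g : V → ℝ := fun z => (‖z + x‖ ^ 2 - ‖x‖ ^ 2) * w z with hg
  have hshift : ∫ y, (‖y‖ ^ 2 - ‖x‖ ^ 2) * w (y - x) ∂μ = ∫ z, g z ∂μ := by
    rw [← integral_sub_right_eq_self g x]
    simp [hg]
  rw [hshift]
  by_cases hInt : Integrable g μ
  · have hcancel : ∀ z, g z + g (-z) = 2 * (‖z‖ ^ 2 * w z) := by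
      intro z
      simp only [hg, hwneg, norm_add_sq_real, norm_neg, inner_neg_left]
      ring
    have hadd := integral_add hInt hInt.comp_neg
    simp only [hcancel] at hadd
    rw [integral_const_mul, integral_neg_eq_self g] at hadd
    linarith
  · rw [integral_undef hInt]
    exact integral_nonneg fun z => mul_nonneg (by positivity) (hw z)

/-- The rescaled kernel has scale-invariant truncated second moments in the plane. -/
lemma integral_norm_sq_mul_rescaled (γ : ℝ → ℝ) {δ : ℝ} (hδ : 0 < δ)
    (Q : Set (EuclideanSpace ℝ (Fin 2))) :
    ∫ z, ‖z‖ ^ 2 * ((δ ^ 4)⁻¹ * γ (‖z‖ / δ) * Q.indicator 1 z) =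
      ∫ ξ, ‖ξ‖ ^ 2 * γ ‖ξ‖ * Q.indicator 1 (δ • ξ) := by
  have hscale := Measure.integral_comp_smul (volume : Measure (EuclideanSpace ℝ (Fin 2)))
    (fun z => ‖z‖ ^ 2 * ((δ ^ 4)⁻¹ * γ (‖z‖ / δ) * Q.indicator 1 z)) δ
  have hfun : ∀ ξ : EuclideanSpace ℝ (Fin 2),
      ‖δ • ξ‖ ^ 2 * ((δ ^ 4)⁻¹ * γ (‖δ • ξ‖ / δ) * Q.indicator 1 (δ • ξ)) =
        (δ ^ 2)⁻¹ * (‖ξ‖ ^ 2 * γ ‖ξ‖ * Q.indicator 1 (δ • ξ)) := by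
    intro ξ
    rw [norm_smul, norm_of_nonneg hδ.le, mul_div_cancel_left₀ _ hδ.ne']
    field_simp
  simp only [hfun] at hscale
  rw [integral_const_mul, finrank_euclideanSpace_fin, abs_of_pos (by positivity), smul_eq_mul]
    at hscale
  exact (mul_left_cancel₀ (by positivity) hscale).symm

/-- Every cap of the unit ball off the origin carries positive second moment. -/
lemma setIntegral_cap_pos {V : Type*} [NormedAddCommGroup V] [InnerProductSpace ℝ V]
    [MeasurableSpace V] [BorelSpace V] {μ : Measure V} [μ.IsOpenPosMeasure] {γ : ℝ → ℝ}
    (hγpos : ∀ t, 0 ≤ t → t < 1 → 0 < γ t) (hInt : Integrable (fun ξ : V => ‖ξ‖ ^ 2 * γ ‖ξ‖) μ)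
    {u : V} (hu : ‖u‖ = 1) {h : ℝ} (h0 : 0 < h) (h1 : h < 1) :
    MeasurableSet {ξ : V | ‖ξ‖ < 1 ∧ h < inner ℝ ξ u} ∧
      0 < ∫ ξ in {ξ : V | ‖ξ‖ < 1 ∧ h < inner ℝ ξ u}, ‖ξ‖ ^ 2 * γ ‖ξ‖ ∂μ := by
  set C : Set V := {ξ | ‖ξ‖ < 1 ∧ h < inner ℝ ξ u}
  have hopen : IsOpen C :=
    (isOpen_lt continuous_norm continuous_const).inter
      (isOpen_lt continuous_const (by fun_prop : Continuous fun ξ : V => inner ℝ ξ u))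
  have hne : C.Nonempty := by
    obtain ⟨t, ht, ht1⟩ := exists_between h1
    refine ⟨t • u, ?_, ?_⟩
    · rwa [norm_smul, hu, mul_one, norm_of_nonneg (h0.trans ht).le]
    · rwa [real_inner_smul_left, real_inner_self_eq_norm_sq, hu, one_pow, mul_one]
  have hpos : ∀ ξ ∈ C, 0 < ‖ξ‖ ^ 2 * γ ‖ξ‖ := by
    rintro ξ ⟨hξ, hξu⟩
    have : ξ ≠ 0 := by
      rintro rfl
      rw [inner_zero_left] at hξu
      exact hξu.not_gt h0
    exact mul_pos (pow_pos (norm_pos_iff.2 this) 2) (hγpos _ (norm_nonneg _) hξ)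
  refine ⟨hopen.measurableSet, ?_⟩
  rw [setIntegral_pos_iff_support_of_nonneg_ae
    (ae_restrict_of_forall_mem hopen.measurableSet fun ξ hξ => (hpos ξ hξ).le) hInt.integrableOn,
    inter_eq_right.2 fun ξ hξ => Function.mem_support.2 (hpos ξ hξ).ne']
  exact hopen.measure_pos μ hne

/-- Non-convergence of the polygonally truncated nonlocal operator applied to
`q(x) = ‖x‖²` when the number of polygon vertices stays bounded:  there is `ε > 0`,
depending only on `N` and `γ`, such that for every admissible family of centrally
symmetric Borel sets `Q δ ⊆ B_δ(0)` contained in convex hulls of at most `N` points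
of `B_δ(0)`, one has `4 - L_δ q(x) ≥ ε` for all small `δ` and all `x ∈ Ω`. -/
theorem polygonal_truncation_not_AC
    (γ : ℝ → ℝ) (hγm : Measurable γ) (hγnn : ∀ t, 0 ≤ γ t)
    (hγpos : ∀ t, 0 ≤ t → t < 1 → 0 < γ t)
    (hγsupp : ∀ t, 1 ≤ t → γ t = 0)
    (hγnorm : ∀ i : Fin 2,
      ∫ ξ in closedBall (0:E) 1, (ξ i) ^ 2 * γ ‖ξ‖ = 1)
    (N : ℕ) :
    ∃ ε > 0, ∀ (Ω : Set E), Ω.Nonempty → IsOpen Ω → Bornology.IsBounded Ω →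
      ∀ (δ₀ : ℝ), 0 < δ₀ → ∀ (Q : ℝ → Set E),
      (∀ δ ∈ Set.Ioc (0:ℝ) δ₀, MeasurableSet (Q δ)) →
      (∀ δ ∈ Set.Ioc (0:ℝ) δ₀, Q δ ⊆ closedBall (0:E) δ) →
      (∀ δ ∈ Set.Ioc (0:ℝ) δ₀, Q δ = -Q δ) →
      (∀ δ ∈ Set.Ioc (0:ℝ) δ₀, ∃ S : Finset E, S.card ≤ N ∧
          (S : Set E) ⊆ closedBall (0:E) δ ∧ Q δ ⊆ convexHull ℝ (S : Set E)) →
      ∀ δ ∈ Set.Ioc (0:ℝ) δ₀, ∀ x ∈ Ω,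
        4 - (2 * ∫ y : E, (‖y‖ ^ 2 - ‖x‖ ^ 2) *
              ((δ ^ 4)⁻¹ * γ (‖y - x‖ / δ) * (Q δ).indicator 1 (y - x))) ≥ ε := by
  obtain ⟨hInt, htot⟩ := integrable_and_integral_norm_sq_mul hγsupp hγnorm
  obtain ⟨u, hu, hu1⟩ := exists_injective_unit_vectors (N + 1)
  obtain ⟨h, h0, h1, hsep⟩ := exists_cap_height hu hu1
  set C : Fin (N + 1) → Set E := fun k => {ξ | ‖ξ‖ < 1 ∧ h < inner ℝ ξ (u k)} with hC
  have hcap := fun k => setIntegral_cap_pos hγpos hInt (hu1 k) h0 h1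
  obtain ⟨k₀, hk₀⟩ := Finite.exists_min fun k => ∫ ξ in C k, ‖ξ‖ ^ 2 * γ ‖ξ‖
  refine ⟨2 * ∫ ξ in C k₀, ‖ξ‖ ^ 2 * γ ‖ξ‖, mul_pos two_pos (hcap k₀).2, ?_⟩
  intro Ω _ _ _ δ₀ _ Q _ _ hQsymm hQhull δ hδ x _
  obtain ⟨S, hScard, hSball, hQS⟩ := hQhull δ hδ
  have hδ0 : 0 < δ := hδ.1
  have hscale : ∀ s : E, ∀ k, h * δ < inner ℝ s (u k) → h < inner ℝ (δ⁻¹ • s) (u k) := by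
    intro s k hs
    rw [real_inner_smul_left, ← div_eq_inv_mul]
    exact (lt_div_iff₀ hδ0).2 hs
  obtain ⟨k, hk⟩ : ∃ k, ∀ s ∈ S, ¬ h * δ < inner ℝ s (u k) := by
    refine exists_forall_not_of_card_lt S (by simpa using Nat.lt_succ_of_le hScard)
      (fun k s => h * δ < inner ℝ s (u k)) fun s hs i j hi hj => ?_
    refine hsep i j (δ⁻¹ • s) ?_ (hscale s i hi) (hscale s j hj)
    have hsδ : ‖s‖ ≤ δ := by simpa using hSball hs
    rw [norm_smul, norm_of_nonneg (inv_nonneg.2 hδ0.le), ← div_eq_inv_mul]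
    exact (div_le_one hδ0).2 hsδ
  have hQhalf : ∀ z ∈ Q δ, inner ℝ z (u k) ≤ h * δ := by
    have hconv : Convex ℝ {z : E | inner ℝ z (u k) ≤ h * δ} :=
      convex_halfSpace_le ⟨fun a b => inner_add_left a b _,
        fun c a => real_inner_smul_left a _ c⟩ _
    exact fun z hz => convexHull_min (fun s hs => not_lt.1 (hk s hs)) hconv (hQS hz)
  have hind : ∀ z : E, (Q δ).indicator (1 : E → ℝ) (-z) = (Q δ).indicator 1 z := by
    intro z
    have hmem : -z ∈ Q δ ↔ z ∈ Q δ := by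
      conv_rhs => rw [hQsymm δ hδ]
      rfl
    by_cases hz : z ∈ Q δ
    · rw [indicator_of_mem hz, indicator_of_mem (hmem.2 hz), Pi.one_apply, Pi.one_apply]
    · rw [indicator_of_notMem hz, indicator_of_notMem (mt hmem.1 hz)]
  have hind0 : ∀ z : E, 0 ≤ (Q δ).indicator (1 : E → ℝ) z :=
    fun z => indicator_nonneg (fun _ _ => zero_le_one) z
  have hF0 : ∀ ξ : E, 0 ≤ ‖ξ‖ ^ 2 * γ ‖ξ‖ := fun ξ => mul_nonneg (sq_nonneg _) (hγnn _)
  have hle := integral_norm_sq_sub_mul_le (μ := (volume : Measure E))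
    (w := fun z => (δ ^ 4)⁻¹ * γ (‖z‖ / δ) * (Q δ).indicator 1 z)
    (fun z => mul_nonneg (mul_nonneg (by positivity) (hγnn _)) (hind0 z))
    (fun z => by simp only [norm_neg, hind]) x
  rw [integral_norm_sq_mul_rescaled γ hδ0] at hle
  have hmono : ∫ ξ : E, ‖ξ‖ ^ 2 * γ ‖ξ‖ * (Q δ).indicator 1 (δ • ξ) ≤
      ∫ ξ in (C k)ᶜ, ‖ξ‖ ^ 2 * γ ‖ξ‖ := by
    rw [← integral_indicator (hcap k).1.compl]
    refine integral_mono_of_nonneg (ae_of_all _ fun ξ => mul_nonneg (hF0 ξ) (hind0 _))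
      (hInt.indicator (hcap k).1.compl) (ae_of_all _ fun ξ => ?_)
    dsimp only
    by_cases hξ : ξ ∈ C k
    · have hξQ : δ • ξ ∉ Q δ := by
        intro hmem
        have := hQhalf _ hmem
        rw [real_inner_smul_left] at this
        nlinarith [hξ.2]
      rw [indicator_of_notMem hξQ, mul_zero]
      exact indicator_nonneg (fun ξ _ => hF0 ξ) ξ
    · rw [indicator_of_mem (show ξ ∈ (C k)ᶜ from hξ)]
      exact mul_le_of_le_one_right (hF0 ξ)
        (indicator_le_self' (f := (1 : E → ℝ)) (fun _ _ => zero_le_one) _)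
  have hsplit := integral_add_compl (hcap k).1 hInt
  rw [htot] at hsplit
  have hmin := hk₀ k
  linarith

end
end

section
/- Let n ≥ 2 and let S be a set of n points on the unit circle {ξ ∈ ℝ² : ‖ξ‖ = 1}. Then there exists a unit vector e ∈ ℝ² such that the convex hull conv(S) is contained in the half-plane {ξ ∈ ℝ² : ⟨ξ, e⟩ ≤ cos(π/n)}. Consequently, the Lebesgue measure of B_1(0) \ conv(S) is at least ½(2π/n − sin(2π/n)) > 0. -/
open MeasureTheory Metric Filter Set Real
open scoped RealInnerProductSpace

noncomputable section

local notation "E" => EuclideanSpace ℝ (Fin 2)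

/-- A point of the unit circle has the form `(cos a, sin a)`. -/
theorem exists_eq_cos_sin {s : E} (hs : ‖s‖ = 1) :
    ∃ a : ℝ, s 0 = Real.cos a ∧ s 1 = Real.sin a := by
  have hz : ‖(⟨s 0, s 1⟩ : ℂ)‖ = 1 := by
    rw [← hs, Complex.norm_def, EuclideanSpace.norm_eq, Complex.normSq_mk]
    simp [Fin.sum_univ_two, sq]
  refine ⟨Complex.arg ⟨s 0, s 1⟩, ?_, ?_⟩
  · simpa [hz] using (Complex.norm_mul_cos_arg ⟨s 0, s 1⟩).symm
  · simpa [hz] using (Complex.norm_mul_sin_arg ⟨s 0, s 1⟩).symm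

theorem cos_norm_addCircle_coe (x : ℝ) :
    Real.cos ‖(x : AddCircle (2 * π))‖ = Real.cos x := by
  rw [AddCircle.norm_eq, Real.cos_abs, Real.cos_sub_int_mul_two_pi]

/-- Finitely many arcs of total length less than `2π` do not cover the circle. -/
theorem exists_forall_cos_sub_lt {ι : Type*} (S : Finset ι) (a : ι → ℝ) {r : ℝ} (hr : 0 ≤ r)
    (hS : S.card * (2 * r) < 2 * π) :
    ∃ t : ℝ, ∀ s ∈ S, Real.cos (t - a s) < Real.cos r := by
  have : Fact (0 < 2 * π) := ⟨Real.two_pi_pos⟩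
  have hlt : volume (⋃ s ∈ S, closedBall (a s : AddCircle (2 * π)) r) <
      volume (Set.univ : Set (AddCircle (2 * π))) := by
    calc volume (⋃ s ∈ S, closedBall (a s : AddCircle (2 * π)) r)
        ≤ ∑ s ∈ S, volume (closedBall (a s : AddCircle (2 * π)) r) :=
          measure_biUnion_finset_le _ _
      _ ≤ ∑ _s ∈ S, ENNReal.ofReal (2 * r) := by
          refine Finset.sum_le_sum fun s _ => ?_
          rw [AddCircle.volume_closedBall]
          exact ENNReal.ofReal_le_ofReal (min_le_right _ _)
      _ = ENNReal.ofReal (S.card * (2 * r)) := by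
          rw [Finset.sum_const, nsmul_eq_mul, ENNReal.ofReal_mul (Nat.cast_nonneg S.card),
            ENNReal.ofReal_natCast]
      _ < ENNReal.ofReal (2 * π) := (ENNReal.ofReal_lt_ofReal_iff Real.two_pi_pos).2 hS
      _ = _ := (AddCircle.measure_univ _).symm
  obtain ⟨x, hx⟩ : ∃ x, x ∉ ⋃ s ∈ S, closedBall (a s : AddCircle (2 * π)) r := by
    by_contra! h
    rw [Set.eq_univ_of_forall h] at hlt
    exact lt_irrefl _ hlt
  induction x using QuotientAddGroup.induction_on with
  | H t =>
    refine ⟨t, fun s hs => ?_⟩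
    have hts : r < ‖((t - a s : ℝ) : AddCircle (2 * π))‖ := by
      by_contra! h
      refine hx (Set.mem_biUnion hs ?_)
      rw [mem_closedBall, dist_eq_norm]
      exact h
    rw [← cos_norm_addCircle_coe]
    refine Real.cos_lt_cos_of_nonneg_of_le_pi hr ?_ hts
    have h := AddCircle.norm_le_half_period (2 * π) (x := ((t - a s : ℝ) : AddCircle (2 * π)))
      Real.two_pi_pos.ne'
    rw [abs_of_pos Real.two_pi_pos] at h
    linarith

theorem exists_norm_eq_one_forall_inner_lt {S : Finset E} (hS : (S : Set E) ⊆ sphere (0 : E) 1)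
    {r : ℝ} (hr : 0 ≤ r) (hcard : S.card * (2 * r) < 2 * π) :
    ∃ e : E, ‖e‖ = 1 ∧ ∀ s ∈ S, ⟪s, e⟫ < Real.cos r := by
  have h : ∀ s : E, ∃ a : ℝ, s ∈ S → s 0 = Real.cos a ∧ s 1 = Real.sin a := by
    intro s
    by_cases hs : s ∈ S
    · obtain ⟨a, ha⟩ := exists_eq_cos_sin (s := s) (by simpa using hS hs)
      exact ⟨a, fun _ => ha⟩
    · exact ⟨0, fun h => absurd h hs⟩
  choose a ha using h
  obtain ⟨t, ht⟩ := exists_forall_cos_sub_lt S a hr hcard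
  refine ⟨!₂[Real.cos t, Real.sin t], ?_, fun s hs => ?_⟩
  · simp [EuclideanSpace.norm_eq, Fin.sum_univ_two]
  · have h := ht s hs
    rw [Real.cos_sub] at h
    simpa [PiLp.inner_apply, Fin.sum_univ_two, ha s hs] using h

/-- A limiting form of `exists_norm_eq_one_forall_inner_lt`, obtained by compactness of the
circle. -/
theorem exists_norm_eq_one_forall_inner_le {S : Finset E} (hne : S.Nonempty)
    (hS : (S : Set E) ⊆ sphere (0 : E) 1) {r : ℝ} (hr : 0 < r) (hcard : S.card * r ≤ π) :
    ∃ e : E, ‖e‖ = 1 ∧ ∀ s ∈ S, ⟪s, e⟫ ≤ Real.cos r := by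
  have hcont : Continuous fun e : E => S.sup' hne fun s => ⟪s, e⟫ :=
    Continuous.finset_sup'_apply hne fun s _ => by fun_prop
  have hsphere : (sphere (0 : E) 1).Nonempty := NormedSpace.sphere_nonempty.2 zero_le_one
  obtain ⟨e, he, hmin⟩ := (isCompact_sphere (0 : E) 1).exists_isMinOn hsphere hcont.continuousOn
  refine ⟨e, by simpa using he, fun s hs => ?_⟩
  refine (Finset.le_sup' (fun s => ⟪s, e⟫) hs).trans ?_
  have hlim : Tendsto Real.cos (nhdsWithin r (Iio r)) (nhds (Real.cos r)) :=
    Real.continuous_cos.continuousWithinAt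
  refine ge_of_tendsto hlim ?_
  filter_upwards [Ioo_mem_nhdsLT hr] with q hq
  have hpos : (0 : ℝ) < S.card := by exact_mod_cast hne.card_pos
  obtain ⟨e', he', hlt⟩ := exists_norm_eq_one_forall_inner_lt hS hq.1.le
    (by nlinarith [mul_lt_mul_of_pos_left hq.2 hpos])
  exact (hmin (by simpa using he')).trans (Finset.sup'_le hne _ fun s hs => (hlt s hs).le)

theorem integral_two_mul_sqrt_one_sub_sq {α : ℝ} (h0 : 0 ≤ α) (hα : α ≤ π) :
    ∫ x in Real.cos α..1, 2 * √(1 - x ^ 2) = 1 / 2 * (2 * α - Real.sin (2 * α)) := by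
  have hderiv : ∀ x ∈ Ioo (Real.cos α) 1,
      HasDerivAt (fun x => x * √(1 - x ^ 2) + Real.arcsin x) (2 * √(1 - x ^ 2)) x := by
    intro x hx
    have hx1 : -1 < x := (Real.neg_one_le_cos α).trans_lt hx.1
    have hpos : 0 < 1 - x ^ 2 := by nlinarith [hx.2]
    have h1 : HasDerivAt (fun x : ℝ => 1 - x ^ 2) (-(2 * x)) x := by
      simpa using (hasDerivAt_pow 2 x).const_sub 1
    refine (((hasDerivAt_id x).mul (h1.sqrt hpos.ne')).add
      (Real.hasDerivAt_arcsin hx1.ne' hx.2.ne)).congr_deriv ?_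
    have hs : √(1 - x ^ 2) ≠ 0 := (Real.sqrt_pos.2 hpos).ne'
    have hsq := Real.sq_sqrt hpos.le
    simp only [id]
    field_simp
    linarith
  rw [intervalIntegral.integral_eq_sub_of_hasDerivAt_of_le (Real.cos_le_one α)
    (Continuous.continuousOn (by fun_prop)) hderiv
    (Continuous.intervalIntegrable (by fun_prop) _ _)]
  have hsin : √(1 - Real.cos α ^ 2) = Real.sin α := by
    rw [← Real.sin_sq, Real.sqrt_sq (Real.sin_nonneg_of_nonneg_of_le_pi h0 hα)]
  have harc : Real.arcsin (Real.cos α) = π / 2 - α := by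
    rw [Real.arcsin_eq_pi_div_two_sub_arccos, Real.arccos_cos h0 hα]
  rw [hsin, harc, Real.arcsin_one, Real.sin_two_mul]
  norm_num
  ring

/-- The area of the circular cap of half-angle `α`, in coordinates. -/
theorem volume_regionBetween_sqrt_one_sub_sq {α : ℝ} (h0 : 0 ≤ α) (hα : α ≤ π) :
    volume (regionBetween (fun x => -√(1 - x ^ 2)) (fun x => √(1 - x ^ 2))
      (Ioc (Real.cos α) 1)) = ENNReal.ofReal (1 / 2 * (2 * α - Real.sin (2 * α))) := by
  have hint : ∀ f : ℝ → ℝ, Continuous f → IntegrableOn f (Ioc (Real.cos α) 1) := fun f hf =>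
    hf.integrableOn_Ioc
  rw [Measure.volume_eq_prod, volume_regionBetween_eq_integral (hint _ (by fun_prop))
    (hint _ (by fun_prop)) measurableSet_Ioc
    (fun x _ => by linarith [Real.sqrt_nonneg (1 - x ^ 2)]),
    ← integral_two_mul_sqrt_one_sub_sq h0 hα,
    intervalIntegral.integral_of_le (Real.cos_le_one α)]
  congr 2
  ext x
  simp only [Pi.sub_apply]
  ring

theorem le_volume_cap {e : E} (he : ‖e‖ = 1) {α : ℝ} (h0 : 0 ≤ α) (hα : α ≤ π) :
    ENNReal.ofReal (1 / 2 * (2 * α - Real.sin (2 * α))) ≤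
      volume (closedBall (0 : E) 1 ∩ {ξ : E | Real.cos α < ⟪ξ, e⟫}) := by
  obtain ⟨b, hb⟩ := Orthonormal.exists_orthonormalBasis_extension_of_card_eq (𝕜 := ℝ)
    (ι := Fin 2) (v := fun _ => e) (s := {0}) (by simp)
    (orthonormal_subsingleton_iff.2 fun _ => he)
  have hb0 : b 0 = e := hb 0 rfl
  have hmp : MeasurePreserving
      (fun ξ : E => MeasurableEquiv.finTwoArrow (WithLp.ofLp (b.repr ξ))) volume volume :=
    (volume_preserving_finTwoArrow ℝ).comp
      ((PiLp.volume_preserving_ofLp (Fin 2)).comp b.measurePreserving_repr)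
  rw [← volume_regionBetween_sqrt_one_sub_sq h0 hα, ← hmp.measure_preimage
    (measurableSet_regionBetween (by fun_prop) (by fun_prop)
      measurableSet_Ioc).nullMeasurableSet]
  refine measure_mono fun ξ hξ => ?_
  obtain ⟨hx, hy⟩ : b.repr ξ 0 ∈ Ioc (Real.cos α) 1 ∧
      b.repr ξ 1 ∈ Ioo (-√(1 - b.repr ξ 0 ^ 2)) √(1 - b.repr ξ 0 ^ 2) := hξ
  refine ⟨?_, ?_⟩
  · have hlt : |b.repr ξ 1| < √(1 - b.repr ξ 0 ^ 2) := abs_lt.2 hy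
    have hsq := (Real.lt_sqrt (abs_nonneg _)).1 hlt
    rw [sq_abs] at hsq
    have hnorm : ‖ξ‖ ^ 2 = b.repr ξ 0 ^ 2 + b.repr ξ 1 ^ 2 := by
      rw [← b.repr.norm_map, EuclideanSpace.norm_sq_eq]
      simp [Fin.sum_univ_two]
    rw [mem_closedBall_zero_iff]
    nlinarith [norm_nonneg ξ]
  · have h := hx.1
    rwa [b.repr_apply_apply, hb0, real_inner_comm] at h

/-- For a set `S` of `n ≥ 2` points on the unit circle, `conv S` lies in a half-plane
`{ξ : ⟪ξ, e⟫ ≤ cos(π/n)}` for some unit vector `e`; consequently the area of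
`B_1(0) \ conv S` is at least `½(2π/n − sin(2π/n)) > 0`. -/
theorem inscribed_polygon_halfplane_and_cap_area
    (n : ℕ) (hn : 2 ≤ n) (S : Finset E) (hcard : S.card = n)
    (hS : (S : Set E) ⊆ sphere (0:E) 1) :
    (∃ e : E, ‖e‖ = 1 ∧
      convexHull ℝ (S : Set E) ⊆ {ξ : E | ⟪ξ, e⟫ ≤ Real.cos (π / n)}) ∧
    (1 / 2) * (2 * π / n - Real.sin (2 * π / n)) ≤
        (volume (closedBall (0:E) 1 \ convexHull ℝ (S : Set E))).toReal ∧
    0 < (1 / 2) * (2 * π / n - Real.sin (2 * π / n)) := by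
  have hn0 : (0 : ℝ) < n := by positivity
  have hα : 0 < π / n := div_pos Real.pi_pos hn0
  have hαπ : π / n ≤ π := div_le_self Real.pi_pos.le (by exact_mod_cast (by omega : 1 ≤ n))
  obtain ⟨e, he, hle⟩ := exists_norm_eq_one_forall_inner_le
    (Finset.card_pos.1 (by omega : 0 < S.card)) hS hα
    (by rw [hcard, mul_div_cancel₀ _ hn0.ne'])
  have hconv : convexHull ℝ (S : Set E) ⊆ {ξ : E | ⟪ξ, e⟫ ≤ Real.cos (π / n)} :=
    convexHull_min (fun s hs => hle s hs)
      (convex_halfSpace_le ⟨fun x y => inner_add_left x y e,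
        fun c x => real_inner_smul_left x e c⟩ _)
  refine ⟨⟨e, he, hconv⟩, ?_, ?_⟩
  · rw [mul_div_assoc, ← ENNReal.ofReal_le_iff_le_toReal]
    · refine (le_volume_cap he hα.le hαπ).trans (measure_mono fun ξ hξ => ⟨hξ.1, fun h => ?_⟩)
      have hξe : ⟪ξ, e⟫ ≤ Real.cos (π / n) := hconv h
      exact hξe.not_gt hξ.2
    · exact measure_ne_top_of_subset sdiff_subset measure_closedBall_lt_top.ne
  · have := Real.sin_lt (x := 2 * π / n) (by positivity)
    linarith

end
end

section
/- For n ≥ 3 let P_n be the regular n-gon inscribed in the closed unit disk, i.e. the convex hull of the points (cos(2πk/n), sin(2πk/n)), k = 0, …, n−1. Then ∫_{P_n} ξ₁² dξ = ∫_{P_n} ξ₂² dξ, and for i = 1,2, (4/π) ∫_{P_n} ξ_i² dξ = (sin(2π/n)/(2π/n)) · (2 + cos(2π/n))/3. Consequently, 2 · (4/π) ∫_{P_n} ‖ξ‖² dξ = C_n, where C_n = (sin(2π/n)/(π/(2n))) · (2 + cos(2π/n))/3. -/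
open MeasureTheory Metric Filter Set Real

noncomputable section

local notation "E" => EuclideanSpace ℝ (Fin 2)

/-- The regular `n`-gon inscribed in the closed unit disk: the convex hull of the
points `(cos(2πk/n), sin(2πk/n))`, `k = 0, …, n−1`. -/
def regularNgon (n : ℕ) : Set E :=
  convexHull ℝ (Set.range fun k : Fin n =>
    ((WithLp.equiv 2 (Fin 2 → ℝ)).symm
      ![Real.cos (2 * π * k / n), Real.sin (2 * π * k / n)] : E))

/-- The regular `n`-gon in the complex plane, spanned by the `n`-th roots of unity. -/
def rootsOfUnityHull (n : ℕ) : Set ℂ :=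
  convexHull ℝ {z : ℂ | z ^ n = 1}

namespace rootsOfUnityHull

variable {n : ℕ}

lemma pow_eq_one_iff_exists_exp (hn : n ≠ 0) {z : ℂ} :
    z ^ n = 1 ↔ ∃ i < n, Complex.exp ((2 * π * i / n : ℝ) * Complex.I) = z := by
  have : NeZero n := ⟨hn⟩
  have hexp (i : ℕ) : Complex.exp ((2 * π * i / n : ℝ) * Complex.I) =
      Complex.exp (2 * π * Complex.I / n) ^ i := by
    rw [← Complex.exp_nat_mul]
    congr 1
    push_cast
    ring
  have hζ := Complex.isPrimitiveRoot_exp n hn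
  simp only [hexp]
  refine ⟨hζ.eq_pow_of_pow_eq_one, ?_⟩
  rintro ⟨i, -, rfl⟩
  rw [pow_right_comm, hζ.pow_eq_one, one_pow]

lemma regularNgon_eq_image (hn : n ≠ 0) :
    regularNgon n = Complex.orthonormalBasisOneI.repr '' rootsOfUnityHull n := by
  have h := (Complex.orthonormalBasisOneI.repr.toLinearEquiv.toLinearMap).image_convexHull
    {z : ℂ | z ^ n = 1}
  refine Eq.trans ?_ h.symm
  unfold regularNgon
  congr 1
  ext x
  simp only [mem_range, mem_image, mem_ofPred_eq, pow_eq_one_iff_exists_exp hn]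
  constructor
  · rintro ⟨k, rfl⟩
    refine ⟨_, ⟨k, k.2, rfl⟩, ?_⟩
    ext i
    fin_cases i <;>
      simp [Complex.orthonormalBasisOneI_repr_apply, Complex.exp_ofReal_mul_I_re,
        Complex.exp_ofReal_mul_I_im, -Complex.ofReal_div, -Complex.ofReal_mul]
  · rintro ⟨_, ⟨k, hk, rfl⟩, rfl⟩
    refine ⟨⟨k, hk⟩, ?_⟩
    ext i
    fin_cases i <;>
      simp [Complex.orthonormalBasisOneI_repr_apply, Complex.exp_ofReal_mul_I_re,
        Complex.exp_ofReal_mul_I_im, -Complex.ofReal_div, -Complex.ofReal_mul]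

lemma convex : Convex ℝ (rootsOfUnityHull n) :=
  convex_convexHull ℝ _

lemma isCompact (hn : n ≠ 0) : IsCompact (rootsOfUnityHull n) := by
  refine Set.Finite.isCompact_convexHull ℝ (s := {z : ℂ | z ^ n = 1}) ?_
  refine ((finite_Iio n).image
    fun i : ℕ => Complex.exp ((2 * π * i / n : ℝ) * Complex.I)).subset fun z hz => ?_
  exact (pow_eq_one_iff_exists_exp hn).1 hz

lemma norm_le_one (hn : n ≠ 0) {z : ℂ} (hz : z ∈ rootsOfUnityHull n) : ‖z‖ ≤ 1 := by
  have h : rootsOfUnityHull n ⊆ closedBall 0 1 :=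
    convexHull_min (fun w hw => by simp [Complex.norm_eq_one_of_pow_eq_one hw hn])
      (convex_closedBall _ _)
  simpa using h hz

lemma mul_mem {w z : ℂ} (hw : w ^ n = 1) (hz : z ∈ rootsOfUnityHull n) :
    w * z ∈ rootsOfUnityHull n := by
  have h := (LinearMap.mulLeft ℝ w).image_convexHull {z : ℂ | z ^ n = 1}
  refine convexHull_mono ?_ (h ▸ mem_image_of_mem _ hz)
  rintro _ ⟨v, hv, rfl⟩
  simp only [mem_ofPred_eq] at hv
  simp [mul_pow, hw, hv]

lemma mul_mem_iff (hn : n ≠ 0) {w z : ℂ} (hw : w ^ n = 1) :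
    w * z ∈ rootsOfUnityHull n ↔ z ∈ rootsOfUnityHull n := by
  refine ⟨fun h => ?_, mul_mem hw⟩
  have hw0 : w ≠ 0 := by
    rintro rfl
    simp [hn] at hw
  have := mul_mem (w := w⁻¹) (by simp [hw]) h
  rwa [inv_mul_cancel_left₀ hw0] at this

lemma zero_mem (hn : 2 ≤ n) : (0 : ℂ) ∈ rootsOfUnityHull n := by
  have hn0 : n ≠ 0 := by omega
  have hζ := Complex.isPrimitiveRoot_exp n hn0
  have h := convex.sum_mem (t := Finset.range n)
    (w := fun _ => (n : ℝ)⁻¹) (z := fun i => Complex.exp (2 * π * Complex.I / n) ^ i)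
    (fun _ _ => by positivity) (by simp [hn0]) (fun i _ => subset_convexHull _ _ (by
      simp only [mem_ofPred_eq]
      rw [pow_right_comm, hζ.pow_eq_one, one_pow]))
  rwa [← Finset.smul_sum, hζ.geom_sum_eq_zero hn, smul_zero] at h

/-- The polygon lies on the inner side of its edge joining `1` to `exp (2πi/n)`. -/
lemma re_mul_exp_le (hn : n ≠ 0) {z : ℂ} (hz : z ∈ rootsOfUnityHull n) :
    z.re * cos (π / n) + z.im * sin (π / n) ≤ cos (π / n) := by
  have hconv : Convex ℝ {z : ℂ | z.re * cos (π / n) + z.im * sin (π / n) ≤ cos (π / n)} :=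
    convex_halfSpace_le (f := fun z : ℂ => z.re * cos (π / n) + z.im * sin (π / n))
      ⟨fun x y => by simp; ring, fun c x => by simp; ring⟩ _
  refine convexHull_min (fun w hw => ?_) hconv hz
  obtain ⟨i, hi, rfl⟩ := (pow_eq_one_iff_exists_exp hn).1 hw
  have hn' : (0 : ℝ) < n := by positivity
  simp only [mem_ofPred_eq, Complex.exp_ofReal_mul_I_re, Complex.exp_ofReal_mul_I_im]
  rw [← cos_sub]
  have hpos : 0 ≤ sin (π * i / n) := by
    apply sin_nonneg_of_nonneg_of_le_pi (by positivity)
    rw [div_le_iff₀ hn']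
    gcongr
  rcases Nat.eq_zero_or_pos i with rfl | hi0
  · simp
  have hi1 : (1 : ℝ) ≤ i := by exact_mod_cast hi0
  have hin : (i : ℝ) ≤ n := by exact_mod_cast hi.le
  have hpos' : 0 ≤ sin (π * (i - 1) / n) := by
    apply sin_nonneg_of_nonneg_of_le_pi
    · have : (0 : ℝ) ≤ i - 1 := by linarith
      positivity
    · rw [div_le_iff₀ hn']
      gcongr
      linarith
  have := cos_sub_cos (2 * π * i / n - π / n) (π / n)
  rw [show (2 * π * i / n - π / n + π / n) / 2 = π * i / n by ring,
    show (2 * π * i / n - π / n - π / n) / 2 = π * (i - 1) / n by ring] at this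
  nlinarith [mul_nonneg hpos hpos']

lemma ray_mem_iff (hn : 3 ≤ n) {r φ : ℝ} (hr : 0 ≤ r) (hφ : φ ∈ Icc 0 (2 * π / n)) :
    (r * (cos φ + sin φ * Complex.I) : ℂ) ∈ rootsOfUnityHull n ↔
      r * cos (φ - π / n) ≤ cos (π / n) := by
  have hn0 : n ≠ 0 := by omega
  have hn3 : (3 : ℝ) ≤ n := by exact_mod_cast hn
  have hn' : (0 : ℝ) < n := by linarith
  have hle : π / n ≤ π / 3 := by gcongr
  have hpos : 0 < π / n := by positivity
  have hθ : 2 * π / n = 2 * (π / n) := by ring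
  rw [hθ] at hφ
  obtain ⟨h0, h1⟩ := hφ
  have hπ := pi_pos
  constructor
  · intro h
    have := re_mul_exp_le hn0 h
    simp [-Complex.ofReal_cos, -Complex.ofReal_sin] at this
    rw [cos_sub]
    linarith
  · intro h
    set s := sin (π / n) with hs
    set c := cos (π / n) with hc
    have hs0 : 0 < s := sin_pos_of_pos_of_lt_pi hpos (by linarith)
    have hc0 : 0 < c := cos_pos_of_mem_Ioo ⟨by linarith, by linarith⟩
    have hsφ : 0 ≤ sin φ := sin_nonneg_of_nonneg_of_le_pi h0 (by linarith)
    have hsφ' : 0 ≤ sin (2 * (π / n) - φ) :=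
      sin_nonneg_of_nonneg_of_le_pi (by linarith) (by linarith)
    have hsc := sin_sq_add_cos_sq (π / n)
    rw [← hs, ← hc] at hsc
    rw [sin_sub, sin_two_mul, cos_two_mul, ← hs, ← hc] at hsφ'
    rw [cos_sub, ← hs, ← hc] at h
    have hv0 : (1 : ℂ) ∈ rootsOfUnityHull n := subset_convexHull _ _ (by simp)
    have hv1 : Complex.exp ((2 * (π / n) : ℝ) * Complex.I) ∈ rootsOfUnityHull n :=
      subset_convexHull _ _ ((pow_eq_one_iff_exists_exp hn0).2
        ⟨1, by omega, by congr 3; push_cast; ring⟩)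
    have key := convex.sum_mem (t := Finset.univ)
      (w := ![r * (2 * s * c * cos φ - (2 * c ^ 2 - 1) * sin φ) / (2 * s * c),
        r * sin φ / (2 * s * c), 1 - r * (cos φ * c + sin φ * s) / c])
      (z := ![1, Complex.exp ((2 * (π / n) : ℝ) * Complex.I), 0])
      (fun i _ => by
        fin_cases i
        · simp only [Fin.zero_eta, Matrix.cons_val_zero]
          positivity
        · simp only [Fin.mk_one, Matrix.cons_val_one, Matrix.cons_val_zero]
          positivity
        · simp only [Fin.reduceFinMk, Matrix.cons_val]
          rw [sub_nonneg, div_le_one hc0]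
          exact h)
      (by
        simp only [Fin.sum_univ_three, Matrix.cons_val]
        field_simp
        linear_combination (-2 * r * sin φ) * hsc)
      (fun i _ => by
        fin_cases i
        · exact hv0
        · exact hv1
        · exact zero_mem (by omega))
    convert key using 1
    simp only [Fin.sum_univ_three, Matrix.cons_val]
    apply Complex.ext
    · simp [Complex.exp_ofReal_mul_I_re, -Complex.ofReal_div, -Complex.ofReal_mul,
        -Complex.ofReal_cos, -Complex.ofReal_sin, cos_two_mul, ← hc]
      field_simp
      ring
    · simp [Complex.exp_ofReal_mul_I_im, -Complex.ofReal_div, -Complex.ofReal_mul,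
        -Complex.ofReal_cos, -Complex.ofReal_sin, sin_two_mul, ← hs, ← hc]
      field_simp

lemma setIntegral_sq_eq_zero (hn : 3 ≤ n) : ∫ z in rootsOfUnityHull n, z ^ 2 = 0 := by
  have hn0 : n ≠ 0 := by omega
  have hζ := Complex.isPrimitiveRoot_exp n hn0
  set w := Complex.exp (2 * π * Complex.I / n) with hw
  have hnorm : ‖w‖ = 1 := Complex.norm_eq_one_of_pow_eq_one hζ.pow_eq_one hn0
  let R := rotation ⟨w, mem_sphere_zero_iff_norm.2 hnorm⟩
  have hR (z : ℂ) : R z = w * z := rfl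
  have h := R.measurePreserving.setIntegral_preimage_emb
    R.toHomeomorph.measurableEmbedding (fun z : ℂ => z ^ 2) (rootsOfUnityHull n)
  have hpre : R ⁻¹' rootsOfUnityHull n = rootsOfUnityHull n := by
    ext z
    simp only [mem_preimage, hR]
    exact mul_mem_iff hn0 hζ.pow_eq_one
  rw [hpre] at h
  simp only [hR, mul_pow, integral_const_mul] at h
  have hne : w ^ 2 ≠ 1 := hζ.pow_ne_one_of_pos_of_lt (by norm_num) (by omega)
  have : (w ^ 2 - 1) * ∫ z in rootsOfUnityHull n, z ^ 2 = 0 := by linear_combination h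
  exact (mul_eq_zero.1 this).resolve_left (sub_ne_zero.2 hne)

/-- The second radial moment of the polygon along the ray of angle `φ`. -/
def radialMoment (n : ℕ) (φ : ℝ) : ℝ :=
  ∫ r in Ioi (0 : ℝ), r • (rootsOfUnityHull n).indicator (fun z => ‖z‖ ^ 2)
    (Complex.polarCoord.symm (r, φ))

lemma radialMoment_periodic (hn : n ≠ 0) :
    Function.Periodic (radialMoment n) (2 * π / n) := by
  intro φ
  have hw : Complex.exp ((2 * π / n : ℝ) * Complex.I) ^ n = 1 :=
    (pow_eq_one_iff_exists_exp hn).2 (by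
      rcases Nat.lt_or_ge 1 n with h | h
      · exact ⟨1, h, by simp⟩
      · obtain rfl : n = 1 := by omega
        exact ⟨0, by omega, by simp⟩)
  have hrot (r : ℝ) : Complex.polarCoord.symm (r, φ + 2 * π / n) =
      Complex.exp ((2 * π / n : ℝ) * Complex.I) * Complex.polarCoord.symm (r, φ) := by
    simp only [Complex.polarCoord_symm_apply, Complex.ofReal_cos, Complex.ofReal_sin,
      ← Complex.exp_mul_I]
    rw [Complex.ofReal_add, add_mul, Complex.exp_add]
    ring
  unfold radialMoment
  classical
  refine setIntegral_congr_fun measurableSet_Ioi fun r _ => ?_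
  rw [hrot]
  simp only [indicator_apply, mul_mem_iff hn hw, norm_mul, Complex.norm_exp_ofReal_mul_I, one_mul]

lemma radialMoment_eq (hn : 3 ≤ n) {φ : ℝ} (hφ : φ ∈ Icc 0 (2 * π / n)) :
    radialMoment n φ = (cos (π / n) / cos (φ - π / n)) ^ 4 / 4 := by
  have hn3 : (3 : ℝ) ≤ n := by exact_mod_cast hn
  have hle : π / n ≤ π / 3 := by gcongr
  have hpos : 0 < π / n := by positivity
  have hθ : 2 * π / n = 2 * (π / n) := by ring
  have hπ := pi_pos
  have hc0 : 0 < cos (π / n) := cos_pos_of_mem_Ioo ⟨by linarith, by linarith⟩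
  have hcφ : 0 < cos (φ - π / n) :=
    cos_pos_of_mem_Ioo ⟨by linarith [hφ.1], by linarith [hφ.2]⟩
  set ρ := cos (π / n) / cos (φ - π / n) with hρ
  have hρ0 : 0 ≤ ρ := by positivity
  have : ∀ r ∈ Ioi (0 : ℝ), r • (rootsOfUnityHull n).indicator (fun z => ‖z‖ ^ 2)
      (Complex.polarCoord.symm (r, φ)) = (Iic ρ).indicator (fun r => r ^ 3) r := by
    intro r hr
    have hmem : Complex.polarCoord.symm (r, φ) ∈ rootsOfUnityHull n ↔ r ∈ Iic ρ := by
      rw [Complex.polarCoord_symm_apply, ray_mem_iff hn (le_of_lt hr) hφ, mem_Iic, hρ,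
        le_div_iff₀ hcφ]
    classical
    simp only [indicator_apply, hmem, Complex.norm_polarCoord_symm, sq_abs, smul_eq_mul]
    split_ifs <;> ring
  rw [radialMoment, setIntegral_congr_fun measurableSet_Ioi this,
    setIntegral_indicator measurableSet_Iic, Ioi_inter_Iic, ← intervalIntegral.integral_of_le hρ0]
  simp
  norm_num

lemma setIntegral_norm_sq_eq_radialMoment (hn : n ≠ 0) :
    ∫ z in rootsOfUnityHull n, ‖z‖ ^ 2 = ∫ φ in (-π)..π, radialMoment n φ := by
  have hmeas : MeasurableSet (rootsOfUnityHull n) := (isCompact hn).measurableSet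
  have hsymm : Measurable fun p : ℝ × ℝ => Complex.polarCoord.symm p := by
    simp only [Complex.polarCoord_symm_apply]
    fun_prop
  rw [← integral_indicator hmeas, ← Complex.integral_comp_polarCoord_symm, polarCoord_target,
    Measure.volume_eq_prod, ← Measure.prod_restrict, integral_prod_symm,
    intervalIntegral.integral_of_le (by linarith [pi_pos]), ← integral_Ioc_eq_integral_Ioo]
  · rfl
  rw [Measure.prod_restrict, ← Measure.volume_eq_prod, ← IntegrableOn]
  have hint : IntegrableOn (fun _ : ℝ × ℝ => (1 : ℝ)) (Icc 0 1 ×ˢ Icc (-π) π) :=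
    integrableOn_const (isCompact_Icc.prod isCompact_Icc).measure_lt_top.ne
  have hint' : IntegrableOn (indicator (Icc 0 1 ×ˢ Icc (-π) π) fun _ : ℝ × ℝ => (1 : ℝ))
      (Ioi 0 ×ˢ Ioo (-π) π) :=
    ((integrable_indicator_iff (measurableSet_Icc.prod measurableSet_Icc)).2 hint).integrableOn
  refine Integrable.mono' hint' ?_ ?_
  · refine Measurable.aestronglyMeasurable (measurable_fst.smul ?_)
    exact (Measurable.indicator (by fun_prop) hmeas).comp hsymm
  · refine ae_restrict_of_forall_mem (measurableSet_Ioi.prod measurableSet_Ioo) ?_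
    rintro ⟨r, φ⟩ ⟨hr, hφ⟩
    simp only [mem_Ioi] at hr
    by_cases hz : Complex.polarCoord.symm (r, φ) ∈ rootsOfUnityHull n
    · have h1 := norm_le_one hn hz
      rw [Complex.norm_polarCoord_symm, abs_of_pos hr] at h1
      have hbox : (r, φ) ∈ Icc (0 : ℝ) 1 ×ˢ Icc (-π) π := ⟨⟨hr.le, h1⟩, Ioo_subset_Icc_self hφ⟩
      rw [indicator_of_mem hz, indicator_of_mem hbox, Complex.norm_polarCoord_symm,
        smul_eq_mul, norm_mul]
      simp only [norm_eq_abs, abs_of_pos hr, abs_pow]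
      nlinarith [pow_le_one₀ hr.le h1 (n := 2)]
    · rw [indicator_of_notMem hz, smul_zero, norm_zero]
      exact indicator_nonneg (fun _ _ => zero_le_one) _

/-- `sec ^ 4` has antiderivative `tan + tan ^ 3 / 3`. -/
lemma hasDerivAt_tan_add_tan_pow_three {x : ℝ} (hx : cos x ≠ 0) :
    HasDerivAt (fun x => tan x + tan x ^ 3 / 3) (1 / cos x ^ 4) x := by
  have h := Real.hasDerivAt_tan hx
  convert! h.add ((h.pow 3).div_const 3) using 1
  rw [tan_eq_sin_div_cos]
  norm_num
  field_simp
  linear_combination (-1) * sin_sq_add_cos_sq x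

lemma intervalIntegral_radialMoment (hn : 3 ≤ n) :
    IntervalIntegrable (radialMoment n) volume 0 (2 * π / n) ∧
    ∫ φ in (0 : ℝ)..(2 * π / n), radialMoment n φ =
      sin (2 * π / n) * (2 + cos (2 * π / n)) / 12 := by
  have hn3 : (3 : ℝ) ≤ n := by exact_mod_cast hn
  have hle : π / n ≤ π / 3 := by gcongr
  have hpos : 0 < π / n := by positivity
  have hθ : 2 * π / n = 2 * (π / n) := by ring
  have hπ := pi_pos
  have hc0 : 0 < cos (π / n) := cos_pos_of_mem_Ioo ⟨by linarith, by linarith⟩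
  have huIcc : uIcc 0 (2 * π / n) = Icc 0 (2 * π / n) := uIcc_of_le (by positivity)
  have hcφ : ∀ φ ∈ uIcc 0 (2 * π / n), cos (φ - π / n) ≠ 0 := by
    intro φ hφ
    rw [huIcc] at hφ
    exact (cos_pos_of_mem_Ioo ⟨by linarith [hφ.1], by linarith [hφ.2]⟩).ne'
  have heq : EqOn (radialMoment n)
      (fun φ => cos (π / n) ^ 4 / 4 * (1 / cos (φ - π / n) ^ 4)) (uIcc 0 (2 * π / n)) := by
    intro φ hφ
    rw [huIcc] at hφ
    rw [radialMoment_eq hn hφ]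
    ring
  have hint : IntervalIntegrable (fun φ => 1 / cos (φ - π / n) ^ 4) volume 0 (2 * π / n) := by
    refine ContinuousOn.intervalIntegrable (ContinuousOn.div (by fun_prop) (by fun_prop) ?_)
    exact fun φ hφ => pow_ne_zero _ (hcφ φ hφ)
  refine ⟨(hint.const_mul _).congr (heq.symm.mono uIoc_subset_uIcc), ?_⟩
  rw [intervalIntegral.integral_congr heq, intervalIntegral.integral_const_mul,
    intervalIntegral.integral_eq_sub_of_hasDerivAt
      (f := fun φ => tan (φ - π / n) + tan (φ - π / n) ^ 3 / 3)
      (fun φ hφ => (hasDerivAt_tan_add_tan_pow_three (hcφ φ hφ)).comp_sub_const φ (π / n)) hint,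
    hθ, zero_sub, tan_neg, show 2 * (π / n) - π / n = π / n by ring, sin_two_mul, cos_two_mul,
    tan_eq_sin_div_cos]
  field_simp
  linear_combination (24 * sin (π / n)) * sin_sq_add_cos_sq (π / n)

lemma setIntegral_norm_sq (hn : 3 ≤ n) :
    ∫ z in rootsOfUnityHull n, ‖z‖ ^ 2 =
      n * (sin (2 * π / n) * (2 + cos (2 * π / n)) / 12) := by
  have hn0 : n ≠ 0 := by omega
  have hper := radialMoment_periodic hn0
  obtain ⟨hint, hval⟩ := intervalIntegral_radialMoment hn
  have h := hper.intervalIntegral_add_zsmul_eq n (-π)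
    (hper.intervalIntegrable₀ (by positivity) hint)
  rw [hper.intervalIntegral_add_eq (-π) 0, zero_add, hval,
    show -π + (n : ℤ) • (2 * π / n) = π by simp; field_simp; ring] at h
  rw [setIntegral_norm_sq_eq_radialMoment hn0, h]
  simp

lemma setIntegral_re_sq_and_im_sq (hn : 3 ≤ n) :
    ∫ z in rootsOfUnityHull n, z.re ^ 2 = (∫ z in rootsOfUnityHull n, ‖z‖ ^ 2) / 2 ∧
    ∫ z in rootsOfUnityHull n, z.im ^ 2 = (∫ z in rootsOfUnityHull n, ‖z‖ ^ 2) / 2 := by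
  have hcomp := isCompact (n := n) (by omega)
  have hre : IntegrableOn (fun z : ℂ => z.re ^ 2) (rootsOfUnityHull n) :=
    ContinuousOn.integrableOn_compact hcomp (by fun_prop)
  have him : IntegrableOn (fun z : ℂ => z.im ^ 2) (rootsOfUnityHull n) :=
    ContinuousOn.integrableOn_compact hcomp (by fun_prop)
  have hsq : IntegrableOn (fun z : ℂ => z ^ 2) (rootsOfUnityHull n) :=
    ContinuousOn.integrableOn_compact hcomp (by fun_prop)
  have hadd : ∫ z in rootsOfUnityHull n, ‖z‖ ^ 2 = (∫ z in rootsOfUnityHull n, z.re ^ 2) +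
      ∫ z in rootsOfUnityHull n, z.im ^ 2 := by
    rw [← integral_add hre him]
    congr 1 with z
    rw [Complex.sq_norm, Complex.normSq_apply]
    ring
  have hsub : (∫ z in rootsOfUnityHull n, z.re ^ 2) - ∫ z in rootsOfUnityHull n, z.im ^ 2 = 0 := by
    rw [← integral_sub hre him, ← Complex.zero_re, ← setIntegral_sq_eq_zero hn,
      ← Complex.reCLM_apply, ← Complex.reCLM.integral_comp_comm hsq]
    congr 1 with z
    simp [pow_two]
  constructor <;> linarith

lemma setIntegral_regularNgon (hn : n ≠ 0) (f : E → ℝ) :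
    ∫ ξ in regularNgon n, f ξ =
      ∫ z in rootsOfUnityHull n, f (Complex.orthonormalBasisOneI.repr z) := by
  rw [regularNgon_eq_image hn]
  exact Complex.orthonormalBasisOneI.measurePreserving_repr.setIntegral_image_emb
    Complex.orthonormalBasisOneI.repr.toHomeomorph.measurableEmbedding _ _

end rootsOfUnityHull

/-- Second moments of the constant kernel `γ ≡ 4/π` over the inscribed regular `n`-gon:
the two coordinate moments agree, each equals `(sin(2π/n)/(2π/n))·(2+cos(2π/n))/3`
after multiplication by `4/π`, and the full second moment equals
`C_n = (sin(2π/n)/(π/(2n)))·(2+cos(2π/n))/3`. -/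
theorem regular_ngon_constant_kernel_moments (n : ℕ) (hn : 3 ≤ n) :
    (∫ ξ in regularNgon n, (ξ 0) ^ 2) = (∫ ξ in regularNgon n, (ξ 1) ^ 2) ∧
    (∀ i : Fin 2,
      (4 / π) * ∫ ξ in regularNgon n, (ξ i) ^ 2 =
        (Real.sin (2 * π / n) / (2 * π / n)) * ((2 + Real.cos (2 * π / n)) / 3)) ∧
    2 * ((4 / π) * ∫ ξ in regularNgon n, ‖ξ‖ ^ 2) =
      (Real.sin (2 * π / n) / (π / (2 * n))) * ((2 + Real.cos (2 * π / n)) / 3) := by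
  have hn0 : n ≠ 0 := by omega
  have hre : ∫ ξ in regularNgon n, (ξ 0) ^ 2 = ∫ z in rootsOfUnityHull n, z.re ^ 2 := by
    simpa [Complex.orthonormalBasisOneI_repr_apply] using
      rootsOfUnityHull.setIntegral_regularNgon hn0 fun ξ => (ξ 0) ^ 2
  have him : ∫ ξ in regularNgon n, (ξ 1) ^ 2 = ∫ z in rootsOfUnityHull n, z.im ^ 2 := by
    simpa [Complex.orthonormalBasisOneI_repr_apply] using
      rootsOfUnityHull.setIntegral_regularNgon hn0 fun ξ => (ξ 1) ^ 2
  have hnorm : ∫ ξ in regularNgon n, ‖ξ‖ ^ 2 = ∫ z in rootsOfUnityHull n, ‖z‖ ^ 2 := by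
    simpa only [LinearIsometryEquiv.norm_map] using
      rootsOfUnityHull.setIntegral_regularNgon hn0 fun ξ => ‖ξ‖ ^ 2
  obtain ⟨h0, h1⟩ := rootsOfUnityHull.setIntegral_re_sq_and_im_sq hn
  have hval := rootsOfUnityHull.setIntegral_norm_sq hn
  rw [hval] at h0 h1
  rw [hre, him, hnorm, h0, h1, hval]
  refine ⟨rfl, fun i => ?_, ?_⟩
  · have hi : ∫ ξ in regularNgon n, (ξ i) ^ 2 =
        n * (sin (2 * π / n) * (2 + cos (2 * π / n)) / 12) / 2 := by
      fin_cases i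
      · exact hre.trans h0
      · exact him.trans h1
    rw [hi]
    field_simp
    ring
  · field_simp
    ring

end
end

section
/- For n ≥ 3 let P_n be the regular n-gon inscribed in the closed unit disk, i.e. the convex hull of the points (cos(2πk/n), sin(2πk/n)), k = 0, …, n−1. Then for i = 1, 2, (3/π) ∫_{P_n} ξ_i² ‖ξ‖^{-1} dξ = (n/π) cos³(π/n) ∫_0^{π/n} (cos θ)^{-3} dθ. -/
open MeasureTheory Metric Filter Set Real intervalIntegral

noncomputable section

local notation "E" => EuclideanSpace ℝ (Fin 2)

/-- The point of the plane with polar coordinates `(r, θ)`. -/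
def polarPoint (r θ : ℝ) : E := !₂[r * Real.cos θ, r * Real.sin θ]

lemma regularNgon_eq (n : ℕ) : regularNgon n =
    convexHull ℝ (Set.range fun k : Fin n => polarPoint 1 (2 * π * k / n)) := by
  simp [regularNgon, polarPoint]

lemma polarPoint_vertex_mem {n : ℕ} (hn : 0 < n) (k : ℕ) :
    polarPoint 1 (2 * π * k / n) ∈ regularNgon n := by
  rw [regularNgon_eq]
  refine subset_convexHull _ _ ⟨⟨k % n, Nat.mod_lt _ hn⟩, ?_⟩
  have hn' : (n : ℝ) ≠ 0 := by positivity
  have h : 2 * π * (k : ℝ) / n = 2 * π * ((k % n : ℕ) : ℝ) / n + (k / n : ℕ) * (2 * π) := by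
    have := congrArg (Nat.cast (R := ℝ)) (Nat.mod_add_div k n)
    push_cast at this
    field_simp
    rw [← this]
  simp only [polarPoint, h, Real.cos_add_nat_mul_two_pi, Real.sin_add_nat_mul_two_pi]

lemma sum_exp_mul_two_pi_div {n : ℕ} (hn : 0 < n) {m : ℕ} (hm : ¬ n ∣ m) (t : ℝ) :
    ∑ k ∈ Finset.range n, Complex.exp (((t + m * (2 * π * k / n) : ℝ) : ℂ) * Complex.I) = 0 := by
  have hn' : (n : ℂ) ≠ 0 := by exact_mod_cast hn.ne'
  have hζ := Complex.isPrimitiveRoot_exp n hn.ne'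
  set ζ := Complex.exp (2 * π * Complex.I / n) with hζ_def
  have h1 : ζ ^ m ≠ 1 := fun h => hm ((hζ.pow_eq_one_iff_dvd m).1 h)
  have h2 : (ζ ^ m) ^ n = 1 := by rw [← pow_mul, mul_comm, pow_mul, hζ.pow_eq_one, one_pow]
  have h3 : ∀ k : ℕ, Complex.exp (((t + m * (2 * π * k / n) : ℝ) : ℂ) * Complex.I)
      = Complex.exp (t * Complex.I) * (ζ ^ m) ^ k := by
    intro k
    rw [hζ_def, ← pow_mul, ← Complex.exp_nat_mul, ← Complex.exp_add]
    congr 1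
    push_cast
    field_simp
  simp_rw [h3]
  rw [← Finset.mul_sum, geom_sum_eq h1, h2]
  simp

lemma sum_cos_mul_two_pi_div {n : ℕ} (hn : 0 < n) {m : ℕ} (hm : ¬ n ∣ m) (t : ℝ) :
    ∑ k ∈ Finset.range n, Real.cos (t + m * (2 * π * k / n)) = 0 := by
  have := congrArg Complex.re (sum_exp_mul_two_pi_div hn hm t)
  simpa only [Complex.re_sum, Complex.exp_ofReal_mul_I_re, Complex.zero_re] using this

lemma sum_sin_mul_two_pi_div {n : ℕ} (hn : 0 < n) {m : ℕ} (hm : ¬ n ∣ m) (t : ℝ) :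
    ∑ k ∈ Finset.range n, Real.sin (t + m * (2 * π * k / n)) = 0 := by
  have := congrArg Complex.im (sum_exp_mul_two_pi_div hn hm t)
  simpa only [Complex.im_sum, Complex.exp_ofReal_mul_I_im, Complex.zero_im] using this

lemma sum_polarPoint_one_sq {n : ℕ} (hn : 3 ≤ n) (i : Fin 2) (t : ℝ) :
    ∑ k ∈ Finset.range n, (polarPoint 1 (t + 2 * π * k / n) i) ^ 2 = n / 2 := by
  have h2 : ¬ n ∣ 2 := fun h => by have := Nat.le_of_dvd two_pos h; omega
  have h := sum_cos_mul_two_pi_div (by omega) h2 (2 * t)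
  have e : ∀ k : ℕ, 2 * t + (2 : ℕ) * (2 * π * k / n) = 2 * (t + 2 * π * k / n) := by
    intro k; push_cast; ring
  simp_rw [e] at h
  have hc : ∑ k ∈ Finset.range n, Real.cos (t + 2 * π * k / n) ^ 2 = n / 2 := by
    simp_rw [Real.cos_sq, Finset.sum_add_distrib, ← Finset.sum_div, h]
    simp
  fin_cases i
  · simpa [polarPoint] using hc
  · simp [polarPoint, Real.sin_sq, hc]
    ring

lemma zero_mem_regularNgon {n : ℕ} (hn : 2 ≤ n) : (0 : E) ∈ regularNgon n := by
  have hn0 : 0 < n := by omega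
  have hn' : (n : ℝ) ≠ 0 := by positivity
  have h1 : ¬ n ∣ 1 := fun h => by have := Nat.le_of_dvd one_pos h; omega
  have key : (0 : E) = ∑ k ∈ Finset.range n, (1 / n : ℝ) • polarPoint 1 (2 * π * k / n) := by
    have hc := sum_cos_mul_two_pi_div hn0 h1 0
    have hs := sum_sin_mul_two_pi_div hn0 h1 0
    simp only [Nat.cast_one, one_mul, zero_add] at hc hs
    rw [← Finset.smul_sum]
    ext i
    fin_cases i
    · simp [polarPoint, hc]
    · simp [polarPoint, hs]
  rw [key]
  refine (convex_convexHull ℝ _).sum_mem (fun _ _ => by positivity) ?_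
    (fun k _ => polarPoint_vertex_mem hn0 k)
  simp [hn']

lemma regularNgon_subset_halfSpace {n k : ℕ} (hk : k < n) {x : E} (hx : x ∈ regularNgon n) :
    x 0 * Real.cos ((2 * k + 1) * π / n) + x 1 * Real.sin ((2 * k + 1) * π / n)
      ≤ Real.cos (π / n) := by
  have hn : (0 : ℝ) < n := by exact_mod_cast (by omega : 0 < n)
  rw [regularNgon_eq] at hx
  have hconv : Convex ℝ {y : E | y 0 * Real.cos ((2 * k + 1) * π / n)
      + y 1 * Real.sin ((2 * k + 1) * π / n) ≤ Real.cos (π / n)} := by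
    refine convex_halfSpace_le (f := fun y : E => y 0 * Real.cos ((2 * k + 1) * π / n)
      + y 1 * Real.sin ((2 * k + 1) * π / n)) ⟨fun x y => ?_, fun a x => ?_⟩ _
    · simp; ring
    · simp; ring
  refine convexHull_min ?_ hconv hx
  rintro _ ⟨j, rfl⟩
  obtain ⟨j, hj⟩ := j
  simp only [polarPoint, one_mul, Set.mem_ofPred_eq, Matrix.cons_val_zero,
    Matrix.cons_val_one]
  rw [← Real.cos_sub, ← sub_nonneg, Real.cos_sub_cos]
  have hjn : (j : ℝ) < n := by exact_mod_cast hj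
  have hkn : (k : ℝ) < n := by exact_mod_cast hk
  have hj0 : (0 : ℝ) ≤ j := j.cast_nonneg
  have hk0 : (0 : ℝ) ≤ k := k.cast_nonneg
  have e1 : (π / n + (2 * π * j / n - (2 * k + 1) * π / n)) / 2 = (j - k) / n * π := by
    field_simp; ring
  have e2 : (π / n - (2 * π * j / n - (2 * k + 1) * π / n)) / 2 = (k + 1 - j) / n * π := by
    field_simp; ring
  rw [e1, e2]
  have hpi := Real.pi_pos
  have hsin : ∀ a : ℝ, 0 ≤ a → a ≤ n → 0 ≤ Real.sin (a / n * π) := fun a h0 h1 =>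
    Real.sin_nonneg_of_nonneg_of_le_pi (by positivity)
      (mul_le_of_le_one_left hpi.le ((div_le_one hn).2 h1))
  rcases le_or_gt j k with h | h
  · have h' : (j : ℝ) ≤ k := by exact_mod_cast h
    have hk1 : (k : ℝ) + 1 ≤ n := by exact_mod_cast hk
    have s1 := hsin (k - j) (by linarith) (by linarith)
    have s2 := hsin (k + 1 - j) (by linarith) (by linarith)
    rw [show ((j : ℝ) - k) / n * π = -((k - j) / n * π) by ring, Real.sin_neg]
    nlinarith [mul_nonneg s1 s2]
  · have h' : (k : ℝ) + 1 ≤ j := by exact_mod_cast h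
    have s1 := hsin (j - k) (by linarith) (by linarith)
    have s2 := hsin (j - (k + 1)) (by linarith) (by linarith)
    rw [show ((k : ℝ) + 1 - j) / n * π = -((j - (k + 1)) / n * π) by ring, Real.sin_neg]
    nlinarith [mul_nonneg s1 s2]

lemma polarPoint_mem_regularNgon_iff {n k : ℕ} (hn : 3 ≤ n) (hk : k < n) {r t : ℝ} (hr : 0 ≤ r)
    (ht0 : 0 ≤ t) (ht1 : t ≤ 2 * π / n) :
    polarPoint r (t + 2 * π * k / n) ∈ regularNgon n ↔
      r * Real.cos (t - π / n) ≤ Real.cos (π / n) := by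
  have hn' : (3 : ℝ) ≤ n := by exact_mod_cast hn
  have hn0 : (0 : ℝ) < n := by linarith
  have hpi := Real.pi_pos
  constructor
  · intro h
    have := regularNgon_subset_halfSpace hk h
    convert this using 1
    rw [show t - π / n = (t + 2 * π * k / n) - (2 * k + 1) * π / n by field_simp; ring,
      Real.cos_sub]
    simp [polarPoint]
    ring
  · intro h
    set δ := π / n with hδ
    have hδ0 : 0 < δ := by positivity
    have hδ1 : δ ≤ π / 3 := by rw [hδ]; gcongr
    have h2δ : 2 * π / n = 2 * δ := by rw [hδ]; ring
    rw [h2δ] at ht1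
    set α := 2 * π * k / n with hα
    have hα1 : 2 * π * (k + 1 : ℕ) / n = α + 2 * δ := by rw [hα, hδ]; push_cast; ring
    have hc : 0 < Real.cos δ := Real.cos_pos_of_mem_Ioo ⟨by linarith, by linarith⟩
    have hs : 0 < Real.sin δ := Real.sin_pos_of_pos_of_lt_pi hδ0 (by linarith)
    have hs2 : 0 < Real.sin (2 * δ) := Real.sin_pos_of_pos_of_lt_pi (by linarith) (by linarith)
    set a := r * Real.sin (2 * δ - t) / Real.sin (2 * δ) with ha
    set b := r * Real.sin t / Real.sin (2 * δ) with hb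
    have ha0 : 0 ≤ a := div_nonneg (mul_nonneg hr
      (Real.sin_nonneg_of_nonneg_of_le_pi (by linarith) (by linarith))) hs2.le
    have hb0 : 0 ≤ b := div_nonneg (mul_nonneg hr
      (Real.sin_nonneg_of_nonneg_of_le_pi (by linarith) (by linarith))) hs2.le
    have hab : a + b ≤ 1 := by
      have e : Real.sin (2 * δ - t) + Real.sin t = 2 * Real.sin δ * Real.cos (t - δ) := by
        rw [show 2 * δ - t = δ - (t - δ) by ring]
        nth_rewrite 2 [show t = δ + (t - δ) by ring]
        rw [Real.sin_sub, Real.sin_add]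
        ring
      rw [ha, hb, ← add_div, ← mul_add, e, div_le_one hs2, Real.sin_two_mul]
      nlinarith
    have v1 := polarPoint_vertex_mem (n := n) (by omega) k
    have v2 := polarPoint_vertex_mem (n := n) (by omega) (k + 1)
    rw [← hα] at v1
    rw [hα1] at v2
    have key : polarPoint r (t + α) = (1 - a - b) • (0 : E) + a • polarPoint 1 α
        + b • polarPoint 1 (α + 2 * δ) := by
      have hC : r * Real.cos t = a + b * Real.cos (2 * δ) := by
        rw [ha, hb, Real.sin_sub]; field_simp; ring
      have hS : r * Real.sin t = b * Real.sin (2 * δ) := by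
        rw [hb]; field_simp
      ext i
      fin_cases i
      · simp [polarPoint, Real.cos_add]
        linear_combination Real.cos α * hC - Real.sin α * hS
      · simp [polarPoint, Real.sin_add]
        linear_combination Real.sin α * hC + Real.cos α * hS
    rw [key]
    have := (convex_convexHull ℝ (Set.range fun k : Fin n =>
      polarPoint 1 (2 * π * k / n))).sum_mem (t := Finset.univ) (w := ![1 - a - b, a, b])
      (z := ![0, polarPoint 1 α, polarPoint 1 (α + 2 * δ)])
    rw [← regularNgon_eq] at this
    have e : 1 - (a + b) + a + b = 1 := by ring
    simpa [Fin.sum_univ_three, e, Fin.forall_fin_succ, ha0, hb0, v1, v2,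
      zero_mem_regularNgon (by omega : 2 ≤ n), hab, sub_sub] using this

lemma norm_polarPoint {r : ℝ} (hr : 0 ≤ r) (θ : ℝ) : ‖polarPoint r θ‖ = r := by
  rw [EuclideanSpace.norm_eq, Real.sqrt_eq_iff_eq_sq (by positivity) hr]
  simp [polarPoint, Fin.sum_univ_two]
  nlinarith [Real.sin_sq_add_cos_sq θ]

lemma polarPoint_apply (r θ : ℝ) (i : Fin 2) : polarPoint r θ i = r * polarPoint 1 θ i := by
  fin_cases i <;> simp [polarPoint]

lemma continuous_polarPoint : Continuous fun p : ℝ × ℝ => polarPoint p.1 p.2 := by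
  unfold polarPoint
  refine (PiLp.continuous_toLp 2 _).comp (continuous_pi fun i => ?_)
  fin_cases i
  · simp; fun_prop
  · simp; fun_prop

lemma periodic_polarPoint (r : ℝ) : Function.Periodic (polarPoint r) (2 * π) := by
  intro θ
  simp [polarPoint]

lemma integral_eq_integral_polarPoint (f : E → ℝ) :
    ∫ x, f x = ∫ p in polarCoord.target, p.1 * f (polarPoint p.1 p.2) := by
  rw [← Complex.orthonormalBasisOneI.measurePreserving_repr.integral_comp
    Complex.orthonormalBasisOneI.repr.toHomeomorph.measurableEmbedding f,
    ← Complex.integral_comp_polarCoord_symm]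
  congr! 4

lemma isCompact_regularNgon (n : ℕ) : IsCompact (regularNgon n) :=
  (Set.finite_range _).isCompact_convexHull ℝ

lemma norm_le_one_of_mem_regularNgon {n : ℕ} {x : E} (hx : x ∈ regularNgon n) : ‖x‖ ≤ 1 := by
  rw [regularNgon_eq] at hx
  have : x ∈ Metric.closedBall (0 : E) 1 := by
    refine convexHull_min ?_ (convex_closedBall _ _) hx
    rintro _ ⟨k, rfl⟩
    simp [norm_polarPoint]
  simpa using this

/-- The integral of `r ^ 2` along the part of the ray of angle `θ` inside the regular `n`-gon. -/
def ngonRayMoment (n : ℕ) (θ : ℝ) : ℝ :=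
  ∫ r in {r | 0 < r ∧ polarPoint r θ ∈ regularNgon n}, r ^ 2

lemma integrableOn_ngon_polar (n : ℕ) (i : Fin 2) :
    IntegrableOn (fun p : ℝ × ℝ => {p : ℝ × ℝ | polarPoint p.1 p.2 ∈ regularNgon n}.indicator
      (fun p => p.1 ^ 2 * polarPoint 1 p.2 i ^ 2) p) (Set.Ioi 0 ×ˢ Set.Ioo (-π) π) := by
  have hmeas : MeasurableSet {p : ℝ × ℝ | polarPoint p.1 p.2 ∈ regularNgon n} :=
    continuous_polarPoint.measurable (isCompact_regularNgon n).measurableSet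
  have hcont : Continuous fun p : ℝ × ℝ => p.1 ^ 2 * polarPoint 1 p.2 i ^ 2 := by
    have := continuous_polarPoint.comp (by fun_prop : Continuous fun p : ℝ × ℝ => ((1 : ℝ), p.2))
    have h2 : Continuous fun p : ℝ × ℝ => polarPoint 1 p.2 i :=
      (EuclideanSpace.proj (𝕜 := ℝ) i).continuous.comp this
    fun_prop
  have hK : IsCompact (Set.Icc (0 : ℝ) 1 ×ˢ Set.Icc (-π) π) := isCompact_Icc.prod isCompact_Icc
  rw [IntegrableOn, integrable_indicator_iff hmeas, IntegrableOn,
    Measure.restrict_restrict hmeas]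
  refine (hcont.continuousOn.integrableOn_compact hK).mono_set ?_
  rintro ⟨r, θ⟩ ⟨hP, hr, hθ⟩
  have h1 := norm_le_one_of_mem_regularNgon hP
  simp only [Set.mem_Ioi] at hr
  rw [norm_polarPoint hr.le] at h1
  exact ⟨⟨hr.le, h1⟩, Set.Ioo_subset_Icc_self hθ⟩

lemma setIntegral_regularNgon_eq (n : ℕ) (i : Fin 2) :
    ∫ ξ in regularNgon n, (ξ i) ^ 2 * ‖ξ‖⁻¹ =
      ∫ θ in (0 : ℝ)..(2 * π), ngonRayMoment n θ * polarPoint 1 θ i ^ 2 := by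
  have hP := (isCompact_regularNgon n).measurableSet
  have hper : Function.Periodic (fun θ => ngonRayMoment n θ * polarPoint 1 θ i ^ 2) (2 * π) := by
    intro θ
    simp only [ngonRayMoment, periodic_polarPoint _ θ]
  have hshift := hper.intervalIntegral_add_eq 0 (-π)
  rw [zero_add, show -π + 2 * π = π by ring] at hshift
  rw [hshift, intervalIntegral.integral_of_le (by linarith [Real.pi_pos]),
    integral_Ioc_eq_integral_Ioo, ← MeasureTheory.integral_indicator hP, integral_eq_integral_polarPoint]
  have htarget : polarCoord.target = Set.Ioi (0 : ℝ) ×ˢ Set.Ioo (-π) π := rfl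
  have hint := integrableOn_ngon_polar n i
  rw [htarget]
  calc _ = ∫ p in Set.Ioi (0 : ℝ) ×ˢ Set.Ioo (-π) π,
      {p : ℝ × ℝ | polarPoint p.1 p.2 ∈ regularNgon n}.indicator
        (fun p => p.1 ^ 2 * polarPoint 1 p.2 i ^ 2) p := by
        refine setIntegral_congr_fun (measurableSet_Ioi.prod measurableSet_Ioo) ?_
        rintro ⟨r, θ⟩ ⟨hr, -⟩
        simp only [Set.mem_Ioi] at hr
        by_cases h : polarPoint r θ ∈ regularNgon n
        · simp only [h, Set.indicator_of_mem, Set.mem_ofPred_eq, norm_polarPoint hr.le,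
            polarPoint_apply r θ i]
          field_simp
        · simp [h]
    _ = _ := by
        rw [IntegrableOn, Measure.volume_eq_prod, ← Measure.prod_restrict] at hint
        rw [Measure.volume_eq_prod, ← Measure.prod_restrict, integral_prod_symm _ hint]
        congr 1
        ext θ
        have hm : MeasurableSet {r : ℝ | polarPoint r θ ∈ regularNgon n} :=
          (continuous_polarPoint.comp (by fun_prop : Continuous fun r : ℝ => (r, θ))).measurable hP
        rw [ngonRayMoment, ← MeasureTheory.integral_mul_const, Set.ofPred_and, Set.inter_comm]
        change _ = ∫ r in _ ∩ Set.Ioi 0, _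
        rw [← Measure.restrict_restrict hm, ← MeasureTheory.integral_indicator hm]
        rfl

lemma ngonRayMoment_eq {n k : ℕ} (hn : 3 ≤ n) (hk : k < n) {t : ℝ} (ht0 : 0 ≤ t)
    (ht1 : t ≤ 2 * π / n) :
    ngonRayMoment n (t + 2 * π * k / n) =
      Real.cos (π / n) ^ 3 / 3 * (Real.cos (t - π / n) ^ 3)⁻¹ := by
  obtain ⟨hc, hct⟩ : 0 < Real.cos (π / n) ∧ 0 < Real.cos (t - π / n) := by
    have hn' : (3 : ℝ) ≤ n := by exact_mod_cast hn
    have hpi := Real.pi_pos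
    have h1 : π / n ≤ π / 3 := by gcongr
    have h0 : 0 < π / n := by positivity
    have h2 : 2 * π / n = 2 * (π / n) := by ring
    exact ⟨Real.cos_pos_of_mem_Ioo ⟨by linarith, by linarith⟩,
      Real.cos_pos_of_mem_Ioo ⟨by linarith, by linarith⟩⟩
  have hset : {r | 0 < r ∧ polarPoint r (t + 2 * π * k / n) ∈ regularNgon n} =
      Set.Ioc 0 (Real.cos (π / n) / Real.cos (t - π / n)) := by
    ext r
    simp only [Set.mem_ofPred_eq, Set.mem_Ioc, le_div_iff₀ hct]
    exact and_congr_right fun hr => polarPoint_mem_regularNgon_iff hn hk hr.le ht0 ht1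
  rw [ngonRayMoment, hset, ← intervalIntegral.integral_of_le (by positivity), integral_pow,
    div_pow]
  norm_num
  ring

lemma continuous_polarPoint_one_apply (i : Fin 2) : Continuous fun θ => polarPoint 1 θ i :=
  (EuclideanSpace.proj (𝕜 := ℝ) i).continuous.comp
    (continuous_polarPoint.comp (by fun_prop : Continuous fun θ : ℝ => ((1 : ℝ), θ)))

lemma integral_shifted_inv_cos_cube {n : ℕ} (hn : 3 ≤ n) :
    ∫ t in (0 : ℝ)..(2 * π / n), (Real.cos (t - π / n) ^ 3)⁻¹ =
      2 * ∫ t in (0 : ℝ)..(π / n), (Real.cos t ^ 3)⁻¹ := by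
  have hpi := Real.pi_pos
  have h0 : 0 < π / n := by positivity
  have h1 : π / n ≤ π / 3 := by gcongr; exact_mod_cast hn
  have hcont : ContinuousOn (fun t : ℝ => (Real.cos t ^ 3)⁻¹) (Set.Icc (-(π / n)) (π / n)) :=
    ContinuousOn.inv₀ (by fun_prop) fun t ht =>
      (pow_pos (Real.cos_pos_of_mem_Ioo ⟨by linarith [ht.1], by linarith [ht.2]⟩) 3).ne'
  rw [intervalIntegral.integral_comp_sub_right (fun t => (Real.cos t ^ 3)⁻¹), zero_sub,
    show 2 * π / n - π / n = π / n by ring,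
    ← intervalIntegral.integral_add_adjacent_intervals (b := 0)]
  · rw [two_mul]
    congr 1
    have := intervalIntegral.integral_comp_neg (a := 0) (b := π / n)
      (fun t => (Real.cos t ^ 3)⁻¹)
    simpa using this.symm
  · refine (hcont.mono (Set.Icc_subset_Icc le_rfl h0.le)).intervalIntegrable_of_Icc (by linarith)
  · refine (hcont.mono (Set.Icc_subset_Icc (by linarith) le_rfl)).intervalIntegrable_of_Icc h0.le

lemma integral_ngonRayMoment_mul {n : ℕ} (hn : 3 ≤ n) (i : Fin 2) :
    ∫ θ in (0 : ℝ)..(2 * π), ngonRayMoment n θ * polarPoint 1 θ i ^ 2 =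
      n * Real.cos (π / n) ^ 3 / 3 * ∫ t in (0 : ℝ)..(π / n), (Real.cos t ^ 3)⁻¹ := by
  have hpi := Real.pi_pos
  have hn' : (n : ℝ) ≠ 0 := by positivity
  have h0 : 0 < π / n := by positivity
  have h1 : π / n ≤ π / 3 := by gcongr; exact_mod_cast hn
  have h2 : 2 * π / n = 2 * (π / n) := by ring
  have hle : 0 ≤ 2 * π / n := by linarith
  set g : ℝ → ℝ := fun θ => ngonRayMoment n θ * polarPoint 1 θ i ^ 2 with hg
  set q : ℝ → ℝ := fun t => Real.cos (π / n) ^ 3 / 3 * (Real.cos (t - π / n) ^ 3)⁻¹ with hq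
  have hu := continuous_polarPoint_one_apply i
  have hqc : ContinuousOn q (Set.Icc 0 (2 * π / n)) :=
    continuousOn_const.mul <| ContinuousOn.inv₀ (by fun_prop) fun t ht =>
      (pow_pos (Real.cos_pos_of_mem_Ioo ⟨by linarith [ht.1], by linarith [ht.2]⟩) 3).ne'
  have hgq : ∀ k < n, Set.EqOn (fun t => g (t + 2 * π * k / n))
      (fun t => q t * polarPoint 1 (t + 2 * π * k / n) i ^ 2) (Set.Icc 0 (2 * π / n)) := by
    intro k hk t ht
    simp only [hg, hq, ngonRayMoment_eq hn hk ht.1 ht.2]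
  have hqi : ∀ k : ℕ, IntervalIntegrable
      (fun t => q t * polarPoint 1 (t + 2 * π * k / n) i ^ 2) volume 0 (2 * π / n) := fun k =>
    (hqc.mul (by fun_prop : Continuous fun t : ℝ =>
      polarPoint 1 (t + 2 * π * k / n) i ^ 2).continuousOn).intervalIntegrable_of_Icc hle
  have hend : ∀ k : ℕ, 2 * π * (k + 1 : ℕ) / n = 2 * π / n + 2 * π * k / n := by
    intro k; push_cast; ring
  have hgi : ∀ k < n, IntervalIntegrable g volume (2 * π * k / n) (2 * π * (k + 1 : ℕ) / n) := by
    intro k hk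
    have := (hqi k).congr (g := fun t => g (t + 2 * π * k / n)) (by
      rw [Set.uIoc_of_le hle]
      intro t ht
      exact (hgq k hk (Set.Ioc_subset_Icc_self ht)).symm)
    simpa only [zero_add, ← hend, sub_add_cancel] using this.comp_sub_right (2 * π * k / n)
  calc ∫ θ in (0 : ℝ)..(2 * π), g θ
      = ∑ k ∈ Finset.range n, ∫ θ in (2 * π * k / n)..(2 * π * (k + 1 : ℕ) / n), g θ := by
        rw [intervalIntegral.sum_integral_adjacent_intervals (a := fun k : ℕ => 2 * π * k / n) hgi]
        simp [hn']
    _ = ∑ k ∈ Finset.range n, ∫ t in (0 : ℝ)..(2 * π / n),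
          q t * polarPoint 1 (t + 2 * π * k / n) i ^ 2 := by
        refine Finset.sum_congr rfl fun k hk => ?_
        rw [hend]
        nth_rewrite 1 [← zero_add (2 * π * k / n)]
        rw [← intervalIntegral.integral_comp_add_right]
        refine intervalIntegral.integral_congr ?_
        rw [Set.uIcc_of_le hle]
        exact hgq k (Finset.mem_range.1 hk)
    _ = ∫ t in (0 : ℝ)..(2 * π / n), q t * (n / 2) := by
        rw [← intervalIntegral.integral_finsetSum fun k _ => hqi k]
        simp_rw [← Finset.mul_sum, sum_polarPoint_one_sq hn]
    _ = _ := by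
        rw [intervalIntegral.integral_mul_const, intervalIntegral.integral_const_mul,
          integral_shifted_inv_cos_cube hn]
        ring

/-- Second moments of the peridynamic kernel `γ(t) = (3/π) t⁻¹` over the inscribed
regular `n`-gon: for `i = 1, 2`,
`(3/π) ∫_{P_n} ξ_i² ‖ξ‖⁻¹ dξ = (n/π) cos³(π/n) ∫_0^{π/n} (cos θ)⁻³ dθ`. -/
theorem regular_ngon_peridynamic_kernel_moments (n : ℕ) (hn : 3 ≤ n) :
    ∀ i : Fin 2,
      (3 / π) * ∫ ξ in regularNgon n, (ξ i) ^ 2 * ‖ξ‖⁻¹ =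
        (n / π) * Real.cos (π / n) ^ 3 * ∫ θ in (0:ℝ)..(π / n), (Real.cos θ ^ 3)⁻¹ := by
  intro i
  rw [setIntegral_regularNgon_eq, integral_ngonRayMoment_mul hn]
  ring

end
end

section
/- Let K ⊂ ℝ² be a compact convex set with 0 ∈ K that is contained in the closed unit disk B_1(0), and let r = sup{t ≥ 0 : B_t(0) ⊆ K} be the radius of the largest closed disk centered at 0 contained in K (so 0 ≤ r ≤ 1). Then the Lebesgue measure of K satisfies |K| ≤ π − ½(θ − sin θ), where θ = 2 arccos(r). In particular, if r ≤ 1 − ε for some ε ∈ (0,1), then |K|/π ≤ 1 − (2 arccos(1−ε) − sin(2 arccos(1−ε)))/(2π) < 1. -/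
open MeasureTheory Metric Set Real

noncomputable section

local notation "E" => EuclideanSpace ℝ (Fin 2)

/-- The area of the part of the unit disk where the first coordinate is at most `s`. -/
def truncatedDiskArea (s : ℝ) : ℝ :=
  π - (1 / 2) * (2 * Real.arccos s - Real.sin (2 * Real.arccos s))

lemma continuous_truncatedDiskArea : Continuous truncatedDiskArea := by
  unfold truncatedDiskArea
  fun_prop

lemma monotone_sub_sin : Monotone fun x : ℝ => x - Real.sin x := by
  intro a b hab
  have h := Real.lipschitzWith_sin.dist_le_mul b a
  rw [Real.dist_eq, Real.dist_eq, abs_of_nonneg (sub_nonneg.2 hab)] at h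
  have h' := (abs_le.1 h).2
  simp only [NNReal.coe_one, one_mul] at h'
  dsimp only
  linarith

lemma monotone_truncatedDiskArea : Monotone truncatedDiskArea := by
  intro a b hab
  have h : 2 * Real.arccos b ≤ 2 * Real.arccos a := by
    linarith [Real.antitone_arccos hab]
  have h' := monotone_sub_sin h
  unfold truncatedDiskArea
  dsimp only at h'
  linarith

lemma truncatedDiskArea_lt_pi {s : ℝ} (hs : s < 1) : truncatedDiskArea s < π := by
  have h := Real.sin_lt (mul_pos two_pos (Real.arccos_pos.2 hs))
  unfold truncatedDiskArea
  linarith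

lemma integral_two_mul_sqrt_one_sub_sq_s14 {s : ℝ} (hs : -1 ≤ s) (hs1 : s ≤ 1) :
    ∫ x in (-1 : ℝ)..s, 2 * √(1 - x ^ 2) = truncatedDiskArea s := by
  have hcont : Continuous fun x : ℝ => 2 * √(1 - x ^ 2) := by fun_prop
  rw [intervalIntegral.integral_eq_sub_of_hasDerivAt_of_le hs
    (f := fun x => x * √(1 - x ^ 2) + Real.arcsin x) (by fun_prop) ?_
    (hcont.intervalIntegrable _ _)]
  · unfold truncatedDiskArea
    rw [Real.sin_two_mul, Real.sin_arccos, Real.cos_arccos hs hs1,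
      Real.arccos_eq_pi_div_two_sub_arcsin]
    norm_num
    ring
  · intro x hx
    have hx1 : x < 1 := hx.2.trans_le hs1
    have hpos : 0 < 1 - x ^ 2 := by nlinarith [hx.1]
    have hd : HasDerivAt (fun x : ℝ => 1 - x ^ 2) (-(2 * x)) x := by
      simpa using (hasDerivAt_pow 2 x).const_sub 1
    refine (((hasDerivAt_id x).mul (hd.sqrt hpos.ne')).add
      (Real.hasDerivAt_arcsin hx.1.ne' hx1.ne)).congr_deriv ?_
    have hs0 : √(1 - x ^ 2) ≠ 0 := (Real.sqrt_pos.2 hpos).ne'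
    simp only [id]
    field_simp
    rw [Real.sq_sqrt hpos.le]
    ring

lemma volume_truncated_disk_prod_le {s : ℝ} (hs : -1 ≤ s) (hs1 : s ≤ 1) :
    volume {p : ℝ × ℝ | p.1 ^ 2 + p.2 ^ 2 ≤ 1 ∧ p.1 ≤ s} ≤
      ENNReal.ofReal (truncatedDiskArea s) := by
  have hmeas : MeasurableSet {p : ℝ × ℝ | p.1 ^ 2 + p.2 ^ 2 ≤ 1 ∧ p.1 ≤ s} := by
    exact IsClosed.measurableSet (IsClosed.inter
      (isClosed_le (f := fun p : ℝ × ℝ => p.1 ^ 2 + p.2 ^ 2) (by fun_prop) continuous_const)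
      (isClosed_le continuous_fst continuous_const))
  have hcont : Continuous fun x : ℝ => 2 * √(1 - x ^ 2) := by fun_prop
  rw [Measure.volume_eq_prod, Measure.prod_apply hmeas,
    ← integral_two_mul_sqrt_one_sub_sq_s14 hs hs1, intervalIntegral.integral_of_le hs,
    ← integral_Icc_eq_integral_Ioc,
    ofReal_integral_eq_lintegral_ofReal (hcont.integrableOn_Icc)
      (Filter.Eventually.of_forall fun x => by positivity),
    ← lintegral_indicator measurableSet_Icc]
  refine lintegral_mono fun x => ?_
  by_cases hx : x ∈ Icc (-1) s
  · rw [indicator_of_mem hx]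
    calc volume (Prod.mk x ⁻¹' {p : ℝ × ℝ | p.1 ^ 2 + p.2 ^ 2 ≤ 1 ∧ p.1 ≤ s})
        ≤ volume (Icc (-√(1 - x ^ 2)) (√(1 - x ^ 2))) := by
          refine measure_mono fun y hy => ?_
          exact abs_le.1 (Real.abs_le_sqrt (by linarith [hy.1]))
      _ = ENNReal.ofReal (2 * √(1 - x ^ 2)) := by
          rw [Real.volume_Icc]
          ring_nf
  · have : Prod.mk x ⁻¹' {p : ℝ × ℝ | p.1 ^ 2 + p.2 ^ 2 ≤ 1 ∧ p.1 ≤ s} = ∅ := by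
      refine eq_empty_of_forall_notMem fun y hy => hx ⟨?_, hy.2⟩
      have h1 : x ^ 2 + y ^ 2 ≤ 1 := hy.1
      nlinarith [sq_nonneg y]
    simp [this]

lemma volume_le_truncatedDiskArea {K : Set E} (hKsub : K ⊆ closedBall (0 : E) 1) {v : E}
    (hv : ‖v‖ = 1) {s : ℝ} (hs : -1 ≤ s) (hs1 : s ≤ 1) (hK : ∀ x ∈ K, inner ℝ v x ≤ s) :
    volume K ≤ ENNReal.ofReal (truncatedDiskArea s) := by
  have horth : Orthonormal ℝ (({0} : Set (Fin 2)).domRestrict fun _ => v) := by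
    refine ⟨fun _ => hv, fun i j hij => ?_⟩
    exact absurd (Subsingleton.elim i j) hij
  obtain ⟨b, hb⟩ := horth.exists_orthonormalBasis_extension_of_card_eq (by simp)
  have hb0 : b 0 = v := hb 0 rfl
  have hmp := (volume_preserving_finTwoArrow ℝ).comp
    ((PiLp.volume_preserving_ofLp (Fin 2)).comp b.measurePreserving_repr)
  refine le_trans ?_ (volume_truncated_disk_prod_le hs hs1)
  refine le_trans (measure_mono fun x hx => ?_) (hmp.measure_preimage_le _)
  have hn : ‖b.repr x‖ ^ 2 ≤ 1 := by
    rw [b.repr.norm_map]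
    have := mem_closedBall_zero_iff.1 (hKsub hx)
    nlinarith [norm_nonneg x]
  rw [EuclideanSpace.real_norm_sq_eq, Fin.sum_univ_two] at hn
  refine ⟨hn, ?_⟩
  change (b.repr x) 0 ≤ s
  rw [b.repr_apply_apply, hb0]
  exact hK x hx

lemma exists_unit_inner_le_of_not_closedBall_subset {K : Set E} (hKclosed : IsClosed K)
    (hKconv : Convex ℝ K) (h0K : (0 : E) ∈ K) {s : ℝ} (hs : ¬ closedBall (0 : E) s ⊆ K) :
    ∃ v : E, ‖v‖ = 1 ∧ ∀ x ∈ K, inner ℝ v x ≤ s := by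
  obtain ⟨y, hys, hyK⟩ := not_subset.1 hs
  obtain ⟨f, u, hfK, hfy⟩ := geometric_hahn_banach_closed_point hKconv hKclosed hyK
  set w : E := (InnerProductSpace.toDual ℝ E).symm f with hw
  have hf : ∀ x, f x = inner ℝ w x := fun x => by simp [hw]
  have hu : 0 < u := by simpa using hfK 0 h0K
  have hwy : u < ‖w‖ * s := by
    rw [hf] at hfy
    exact hfy.trans_le ((real_inner_le_norm w y).trans
      (mul_le_mul_of_nonneg_left (mem_closedBall_zero_iff.1 hys) (norm_nonneg w)))
  have hw0 : 0 < ‖w‖ := by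
    refine (norm_nonneg w).lt_of_ne fun h => ?_
    rw [← h, zero_mul] at hwy
    linarith
  refine ⟨‖w‖⁻¹ • w, ?_, fun x hx => ?_⟩
  · rw [norm_smul, norm_inv, norm_norm, inv_mul_cancel₀ hw0.ne']
  · rw [real_inner_smul_left, inv_mul_le_iff₀ hw0, ← hf]
    exact ((hfK x hx).trans hwy).le

/-- Area bound for a compact convex subset `K` of the closed unit disk containing the
origin, in terms of its center-inradius `r = sup{t : B_t(0) ⊆ K}`:
`|K| ≤ π − ½(θ − sin θ)` with `θ = 2 arccos r`.  In particular, if `r ≤ 1 − ε` then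
`|K|/π ≤ 1 − (2 arccos(1−ε) − sin(2 arccos(1−ε)))/(2π) < 1`. -/
theorem convex_area_bound_from_center_inradius
    (K : Set E) (hKcpt : IsCompact K) (hKconv : Convex ℝ K)
    (h0K : (0:E) ∈ K) (hKsub : K ⊆ closedBall (0:E) 1)
    (r : ℝ) (hrdef : r = sSup {t : ℝ | 0 ≤ t ∧ closedBall (0:E) t ⊆ K}) :
    (volume K).toReal ≤
      π - (1 / 2) * (2 * Real.arccos r - Real.sin (2 * Real.arccos r)) ∧
    ∀ ε ∈ Set.Ioo (0:ℝ) 1, r ≤ 1 - ε →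
      (volume K).toReal / π ≤
          1 - (2 * Real.arccos (1 - ε) - Real.sin (2 * Real.arccos (1 - ε))) / (2 * π) ∧
      1 - (2 * Real.arccos (1 - ε) - Real.sin (2 * Real.arccos (1 - ε))) / (2 * π) < 1 := by
  have hbdd : ∀ t ∈ {t : ℝ | 0 ≤ t ∧ closedBall (0:E) t ⊆ K}, t ≤ 1 := by
    rintro t ⟨ht0, ht⟩
    have hmem : EuclideanSpace.single (0 : Fin 2) t ∈ closedBall (0:E) t := by
      simp [abs_of_nonneg ht0]
    simpa [abs_of_nonneg ht0] using hKsub (ht hmem)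
  have h0mem : (0:ℝ) ∈ {t : ℝ | 0 ≤ t ∧ closedBall (0:E) t ⊆ K} := by
    simpa using h0K
  have hr0 : 0 ≤ r := hrdef ▸ le_csSup ⟨1, hbdd⟩ h0mem
  have hr1 : r ≤ 1 := hrdef ▸ csSup_le ⟨0, h0mem⟩ hbdd
  have htoReal : ∀ {a : ℝ}, 0 ≤ a → volume K ≤ ENNReal.ofReal a → (volume K).toReal ≤ a :=
    fun ha h => ENNReal.toReal_le_of_le_ofReal ha h
  have hnonneg : ∀ {s : ℝ}, 0 ≤ s → 0 ≤ truncatedDiskArea s := fun {s} hs => by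
    refine le_trans ?_ (monotone_truncatedDiskArea hs)
    have hzero : truncatedDiskArea 0 = π / 2 := by
      rw [truncatedDiskArea, Real.arccos_zero, mul_div_cancel₀ _ two_ne_zero, Real.sin_pi]
      ring
    rw [hzero]
    positivity
  have hmain : (volume K).toReal ≤ truncatedDiskArea r := by
    rcases hr1.eq_or_lt with rfl | hlt
    · refine htoReal (hnonneg zero_le_one) ((measure_mono hKsub).trans ?_)
      rw [EuclideanSpace.volume_closedBall_fin_two]
      simp [truncatedDiskArea]
    · refine ge_of_tendsto (continuous_truncatedDiskArea.continuousAt.tendsto.mono_left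
        (nhdsWithin_le_nhds (s := Ioi r))) ?_
      filter_upwards [Ioo_mem_nhdsGT hlt] with s hs
      have hs0 : 0 ≤ s := hr0.trans hs.1.le
      have hnot : ¬ closedBall (0:E) s ⊆ K := fun h =>
        hs.1.not_ge (hrdef ▸ le_csSup ⟨1, hbdd⟩ ⟨hs0, h⟩)
      obtain ⟨v, hv, hvK⟩ :=
        exists_unit_inner_le_of_not_closedBall_subset hKcpt.isClosed hKconv h0K hnot
      exact htoReal (hnonneg hs0)
        (volume_le_truncatedDiskArea hKsub hv (by linarith) hs.2.le hvK)
  refine ⟨hmain, fun ε hε hrε => ?_⟩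
  have hratio : 1 - (2 * Real.arccos (1 - ε) - Real.sin (2 * Real.arccos (1 - ε))) / (2 * π) =
      truncatedDiskArea (1 - ε) / π := by
    unfold truncatedDiskArea
    field_simp
  rw [hratio, div_lt_one pi_pos]
  exact ⟨div_le_div_of_nonneg_right (hmain.trans (monotone_truncatedDiskArea hrε)) pi_pos.le,
    truncatedDiskArea_lt_pi (by linarith [hε.1])⟩

end
end

section
/- Let d ≥ 1, let γ : [0,∞) → [0,∞) be measurable with γ(t) = 0 for t ≥ 1 and ∫_{B_1(0)} ξ_i² γ(‖ξ‖) dξ = 1 for every i = 1,…,d, and set γ̃_δ(r) = δ^{-(d+2)} γ(r/δ). Let D ⊂ ℝ^d be a bounded open set, let δ_k → 0, and let u : ℝ^d → ℝ be twice continuously differentiable with bounded first and second derivatives. Then lim_{k→∞} ∫_D ∫_D |u(y) − u(x)|² γ̃_{δ_k}(‖y − x‖) dy dx = ∫_D ‖∇u(x)‖² dx. -/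
open MeasureTheory Metric Filter Set Real
open scoped Topology

noncomputable section

/-- The reflection of Euclidean space that flips the sign of the `i`-th coordinate. -/
def coordFlip {d : ℕ} (i : Fin d) :
    EuclideanSpace ℝ (Fin d) ≃ₗᵢ[ℝ] EuclideanSpace ℝ (Fin d) :=
  LinearIsometryEquiv.piLpCongrRight 2
    (fun j => if j = i then LinearIsometryEquiv.neg ℝ else LinearIsometryEquiv.refl ℝ ℝ)

lemma coordFlip_apply_same {d : ℕ} (i : Fin d) (z : EuclideanSpace ℝ (Fin d)) :
    coordFlip i z i = -z i := by
  simp [coordFlip]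

lemma coordFlip_apply_of_ne {d : ℕ} {i j : Fin d} (h : j ≠ i)
    (z : EuclideanSpace ℝ (Fin d)) : coordFlip i z j = z j := by
  simp [coordFlip, h]

/-- Mixed second moments of a radial weight vanish. -/
lemma integral_mul_coord_radial_eq_zero {d : ℕ} (γ : ℝ → ℝ) {i j : Fin d} (h : j ≠ i) :
    ∫ z : EuclideanSpace ℝ (Fin d), z i * z j * γ ‖z‖ = 0 := by
  have key := (coordFlip i).measurePreserving.integral_comp
    (coordFlip i).toHomeomorph.measurableEmbedding
    (fun z : EuclideanSpace ℝ (Fin d) => z i * z j * γ ‖z‖)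
  simp only [coordFlip_apply_same, coordFlip_apply_of_ne h, LinearIsometryEquiv.norm_map,
    neg_mul, integral_neg] at key
  linarith

/-- A weight with integrable diagonal second moments has an integrable full second moment. -/
lemma integrable_norm_sq_mul_radial {d : ℕ} {γ : ℝ → ℝ}
    (hint : ∀ i : Fin d, Integrable fun z : EuclideanSpace ℝ (Fin d) => (z i) ^ 2 * γ ‖z‖) :
    Integrable fun z : EuclideanSpace ℝ (Fin d) => ‖z‖ ^ 2 * γ ‖z‖ := by
  have h := integrable_finsetSum Finset.univ fun i _ => hint i
  refine h.congr (Eventually.of_forall fun z => ?_)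
  simp only [EuclideanSpace.real_norm_sq_eq z, Finset.sum_mul]

/-- The second moment in any direction of a radial weight normalized along the axes. -/
lemma integral_apply_sq_mul_radial {d : ℕ} {γ : ℝ → ℝ} (hγm : Measurable γ)
    (hγnn : ∀ t, 0 ≤ γ t)
    (hint : ∀ i : Fin d, Integrable fun z : EuclideanSpace ℝ (Fin d) => (z i) ^ 2 * γ ‖z‖)
    (hone : ∀ i : Fin d, ∫ z : EuclideanSpace ℝ (Fin d), (z i) ^ 2 * γ ‖z‖ = 1)
    (L : EuclideanSpace ℝ (Fin d) →L[ℝ] ℝ) :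
    ∫ z, (L z) ^ 2 * γ ‖z‖ = ‖L‖ ^ 2 := by
  obtain ⟨v, rfl⟩ := (InnerProductSpace.toDual ℝ (EuclideanSpace ℝ (Fin d))).surjective L
  rw [LinearIsometryEquiv.norm_map, EuclideanSpace.real_norm_sq_eq]
  have hmixed (i j : Fin d) :
      Integrable fun z : EuclideanSpace ℝ (Fin d) => z i * z j * γ ‖z‖ := by
    refine (integrable_norm_sq_mul_radial hint).mono' (by fun_prop)
      (Eventually.of_forall fun z => ?_)
    rw [norm_mul, norm_mul, Real.norm_of_nonneg (hγnn _), sq]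
    have hi := PiLp.norm_apply_le z i
    have hj := PiLp.norm_apply_le z j
    have := hγnn ‖z‖
    gcongr
  have hexpand (z : EuclideanSpace ℝ (Fin d)) :
      (InnerProductSpace.toDual ℝ (EuclideanSpace ℝ (Fin d)) v z) ^ 2 * γ ‖z‖ =
        ∑ i, ∑ j, v i * v j * (z i * z j * γ ‖z‖) := by
    simp only [InnerProductSpace.toDual_apply_apply, PiLp.inner_apply, sq,
      Finset.mul_sum, Finset.sum_mul]
    refine Finset.sum_congr rfl fun i _ => Finset.sum_congr rfl fun j _ => ?_
    simp only [RCLike.inner_apply, conj_trivial]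
    ring
  simp only [hexpand]
  rw [integral_finsetSum _ fun i _ =>
    integrable_finsetSum _ fun j _ => (hmixed i j).const_mul _]
  refine Finset.sum_congr rfl fun i _ => ?_
  rw [integral_finsetSum _ fun j _ => (hmixed i j).const_mul _]
  simp only [integral_const_mul]
  rw [Finset.sum_eq_single i]
  · simp only [← sq, hone, mul_one]
  · intro j _ hj
    rw [integral_mul_coord_radial_eq_zero γ hj, mul_zero]
  · simp

/-- Rescaling `y = x + δ z` in the inner integral of the nonlocal energy. -/
lemma setIntegral_rescaled_kernel {d : ℕ} (γ : ℝ → ℝ) {D : Set (EuclideanSpace ℝ (Fin d))}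
    (hD : MeasurableSet D) (u : EuclideanSpace ℝ (Fin d) → ℝ) {δ : ℝ} (hδ : 0 < δ)
    (x : EuclideanSpace ℝ (Fin d)) :
    ∫ y in D, (u y - u x) ^ 2 * ((δ ^ (d + 2))⁻¹ * γ (‖y - x‖ / δ)) =
      ∫ z, D.indicator 1 (x + δ • z) * (((u (x + δ • z) - u x) / δ) ^ 2 * γ ‖z‖) := by
  rw [← integral_indicator hD, ← integral_add_left_eq_self _ x]
  have hscale := Measure.integral_comp_smul (volume : Measure (EuclideanSpace ℝ (Fin d)))
    (fun w => D.indicator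
      (fun y => (u y - u x) ^ 2 * ((δ ^ (d + 2))⁻¹ * γ (‖y - x‖ / δ))) (x + w)) δ
  rw [finrank_euclideanSpace_fin, abs_of_pos (by positivity), smul_eq_mul] at hscale
  have hpow : δ ^ d ≠ 0 := by positivity
  rw [eq_inv_mul_iff_mul_eq₀ hpow] at hscale
  rw [← hscale, ← integral_const_mul]
  refine integral_congr_ae (Eventually.of_forall fun z => ?_)
  by_cases hz : x + δ • z ∈ D
  · simp only [indicator_of_mem hz, Pi.one_apply, one_mul, add_sub_cancel_left, norm_smul,
      Real.norm_of_nonneg hδ.le, mul_div_cancel_left₀ _ hδ.ne']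
    field_simp
    ring
  · simp [indicator_of_notMem hz]

lemma norm_indicator_mul_quotient_sq_le {d : ℕ} {γ : ℝ → ℝ} (hγnn : ∀ t, 0 ≤ γ t)
    (D : Set (EuclideanSpace ℝ (Fin d))) {u : EuclideanSpace ℝ (Fin d) → ℝ} {M : ℝ}
    (hlip : ∀ x y, |u y - u x| ≤ M * ‖y - x‖) {δ : ℝ} (hδ : 0 < δ)
    (x z : EuclideanSpace ℝ (Fin d)) :
    ‖D.indicator (1 : EuclideanSpace ℝ (Fin d) → ℝ) (x + δ • z) *
        (((u (x + δ • z) - u x) / δ) ^ 2 * γ ‖z‖)‖ ≤ M ^ 2 * (‖z‖ ^ 2 * γ ‖z‖) := by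
  have hq : |(u (x + δ • z) - u x) / δ| ≤ M * ‖z‖ := by
    have h := hlip x (x + δ • z)
    rw [add_sub_cancel_left, norm_smul, Real.norm_of_nonneg hδ.le] at h
    rw [abs_div, abs_of_pos hδ, div_le_iff₀ hδ]
    linarith
  have hq2 : ((u (x + δ • z) - u x) / δ) ^ 2 ≤ M ^ 2 * ‖z‖ ^ 2 := by
    rw [← sq_abs, ← mul_pow]
    gcongr
  have hγ := hγnn ‖z‖
  have hbound : ((u (x + δ • z) - u x) / δ) ^ 2 * γ ‖z‖ ≤ M ^ 2 * (‖z‖ ^ 2 * γ ‖z‖) := by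
    rw [← mul_assoc]
    gcongr
  have hnn : 0 ≤ ((u (x + δ • z) - u x) / δ) ^ 2 * γ ‖z‖ := by positivity
  by_cases hz : x + δ • z ∈ D
  · rwa [indicator_of_mem hz, Pi.one_apply, one_mul, Real.norm_of_nonneg hnn]
  · rw [indicator_of_notMem hz, zero_mul, norm_zero]
    exact hnn.trans hbound

lemma tendsto_indicator_mul_quotient_sq {d : ℕ} (γ : ℝ → ℝ)
    {D : Set (EuclideanSpace ℝ (Fin d))} (hDo : IsOpen D)
    {u : EuclideanSpace ℝ (Fin d) → ℝ} {δ : ℕ → ℝ} (hδpos : ∀ k, 0 < δ k)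
    (hδ0 : Tendsto δ atTop (𝓝 0)) {x : EuclideanSpace ℝ (Fin d)} (hx : x ∈ D)
    (hu : DifferentiableAt ℝ u x) (z : EuclideanSpace ℝ (Fin d)) :
    Tendsto (fun k => D.indicator (1 : EuclideanSpace ℝ (Fin d) → ℝ) (x + δ k • z) *
        (((u (x + δ k • z) - u x) / δ k) ^ 2 * γ ‖z‖))
      atTop (𝓝 ((fderiv ℝ u x z) ^ 2 * γ ‖z‖)) := by
  have hpt : Tendsto (fun k => x + δ k • z) atTop (𝓝 x) := by
    simpa using (hδ0.smul_const z).const_add x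
  have hδ' : Tendsto δ atTop (𝓝[≠] 0) :=
    tendsto_nhdsWithin_iff.2 ⟨hδ0, Eventually.of_forall fun k => (hδpos k).ne'⟩
  have hq := (hu.hasFDerivAt.hasLineDerivAt z).tendsto_slope_zero.comp hδ'
  refine ((hq.pow 2).mul_const (γ ‖z‖)).congr' ?_
  filter_upwards [hpt.eventually (hDo.mem_nhds hx)] with k hk
  simp [indicator_of_mem hk, div_eq_inv_mul]

/-- Bourgain–Brezis–Mironescu-type limit of the nonlocal energies with rescaled kernels
`γ̃_δ(r) = δ^{-(d+2)} γ(r/δ)` over a bounded open set `D ⊂ ℝ^d`, for a `C²` function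
with bounded first and second derivatives:
`∫_D ∫_D |u(y) − u(x)|² γ̃_{δ_k}(‖y − x‖) dy dx → ∫_D ‖∇u‖²`. -/
theorem bbm_limit
    (d : ℕ) (hd : 1 ≤ d) (γ : ℝ → ℝ) (hγm : Measurable γ) (hγnn : ∀ t, 0 ≤ γ t)
    (hγsupp : ∀ t, 1 ≤ t → γ t = 0)
    (hγnorm : ∀ i : Fin d,
      ∫ ξ in closedBall (0 : EuclideanSpace ℝ (Fin d)) 1, (ξ i) ^ 2 * γ ‖ξ‖ = 1)
    (D : Set (EuclideanSpace ℝ (Fin d))) (hDo : IsOpen D) (hDb : Bornology.IsBounded D)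
    (δ : ℕ → ℝ) (hδpos : ∀ k, 0 < δ k) (hδ0 : Tendsto δ atTop (nhds 0))
    (u : EuclideanSpace ℝ (Fin d) → ℝ) (hu : ContDiff ℝ 2 u)
    (M : ℝ) (hM : ∀ x, ‖fderiv ℝ u x‖ ≤ M ∧ ‖iteratedFDeriv ℝ 2 u x‖ ≤ M) :
    Tendsto (fun k =>
        ∫ x in D, ∫ y in D, (u y - u x) ^ 2 * ((δ k ^ (d + 2))⁻¹ * γ (‖y - x‖ / δ k)))
      atTop (nhds (∫ x in D, ‖fderiv ℝ u x‖ ^ 2)) := by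
  have hfull (i : Fin d) :
      ∫ z : EuclideanSpace ℝ (Fin d), (z i) ^ 2 * γ ‖z‖ = 1 := by
    rw [← hγnorm i, setIntegral_eq_integral_of_forall_compl_eq_zero]
    intro z hz
    rw [mem_closedBall_zero_iff, not_le] at hz
    rw [hγsupp _ hz.le, mul_zero]
  have hint (i : Fin d) :
      Integrable fun z : EuclideanSpace ℝ (Fin d) => (z i) ^ 2 * γ ‖z‖ :=
    Integrable.of_integral_ne_zero (by rw [hfull i]; exact one_ne_zero)
  have hdiff : Differentiable ℝ u := hu.differentiable two_ne_zero
  have hlip (x y : EuclideanSpace ℝ (Fin d)) : |u y - u x| ≤ M * ‖y - x‖ :=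
    convex_univ.norm_image_sub_le_of_norm_fderiv_le (fun w _ => hdiff w)
      (fun w _ => (hM w).1) (mem_univ x) (mem_univ y)
  have hum : Measurable u := hu.continuous.measurable
  have hdom := (integrable_norm_sq_mul_radial hint).const_mul (M ^ 2)
  refine tendsto_integral_of_dominated_convergence
    (fun _ => ∫ z : EuclideanSpace ℝ (Fin d), M ^ 2 * (‖z‖ ^ 2 * γ ‖z‖)) ?_ ?_ ?_ ?_
  · intro k
    refine (StronglyMeasurable.integral_prod_right
      (f := fun x y : EuclideanSpace ℝ (Fin d) =>
        (u y - u x) ^ 2 * ((δ k ^ (d + 2))⁻¹ * γ (‖y - x‖ / δ k))) ?_).aestronglyMeasurable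
    apply Measurable.stronglyMeasurable
    simp only [Function.uncurry_def]
    fun_prop
  · exact integrableOn_const hDb.measure_lt_top.ne
  · intro k
    refine Eventually.of_forall fun x => ?_
    rw [setIntegral_rescaled_kernel γ hDo.measurableSet u (hδpos k) x]
    exact norm_integral_le_of_norm_le hdom (Eventually.of_forall fun z =>
      norm_indicator_mul_quotient_sq_le hγnn D hlip (hδpos k) x z)
  · filter_upwards [ae_restrict_mem hDo.measurableSet] with x hx
    simp only [setIntegral_rescaled_kernel γ hDo.measurableSet u (hδpos _) x]
    rw [← integral_apply_sq_mul_radial hγm hγnn hint hfull (fderiv ℝ u x)]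
    refine tendsto_integral_of_dominated_convergence _ (fun k => ?_) hdom
      (fun k => Eventually.of_forall fun z =>
        norm_indicator_mul_quotient_sq_le hγnn D hlip (hδpos k) x z)
      (Eventually.of_forall fun z =>
        tendsto_indicator_mul_quotient_sq γ hDo hδpos hδ0 hx (hdiff x) z)
    have hind : Measurable (D.indicator (1 : EuclideanSpace ℝ (Fin d) → ℝ)) :=
      measurable_one.indicator hDo.measurableSet
    apply Measurable.aestronglyMeasurable
    fun_prop

end
end

section
/- Let d ≥ 1, let γ : [0,∞) → [0,∞) be measurable with γ(t) = 0 for t ≥ 1 and ∫_{B_1(0)} ξ_i² γ(‖ξ‖) dξ = 1 for every i = 1,…,d, and set γ̃_δ(r) = δ^{-(d+2)} γ(r/δ). Let D ⊂ ℝ^d be a bounded open set, let δ_k → 0, and let r_k ∈ (0, δ_k] satisfy lim_{k→∞} ∫_{‖z‖ ≤ r_k} z_i² γ̃_{δ_k}(‖z‖) dz = 1 for every i = 1,…,d. Let u : ℝ^d → ℝ be twice continuously differentiable with bounded first and second derivatives. Then lim_{k→∞} ∫_D ∫_D |u(y) − u(x)|² γ̃_{δ_k}(‖y − x‖) 1_{‖y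 − x‖ ≤ r_k} dy dx = ∫_D ‖∇u(x)‖² dx. -/
open MeasureTheory Metric Filter Set Real
open scoped Topology

noncomputable section

/-- The second moment of a radial kernel in direction `v` is `‖v‖ ^ 2` times its second moment
along any coordinate axis. -/
theorem integral_inner_sq_mul_radial {d : ℕ} (g : ℝ → ℝ) (v : EuclideanSpace ℝ (Fin d))
    (i : Fin d) :
    ∫ z : EuclideanSpace ℝ (Fin d), inner ℝ v z ^ 2 * g ‖z‖
      = ‖v‖ ^ 2 * ∫ z : EuclideanSpace ℝ (Fin d), z i ^ 2 * g ‖z‖ := by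
  set w : EuclideanSpace ℝ (Fin d) := ‖v‖ • EuclideanSpace.single i (1 : ℝ) with hw
  have hvw : ‖v‖ = ‖w‖ := by simp [hw, norm_smul]
  set R := Submodule.reflection (ℝ ∙ (v - w))ᗮ
  have hR : R v = w := Submodule.reflection_sub hvw
  rw [← R.measurePreserving.integral_comp R.toHomeomorph.measurableEmbedding
      (fun z => z i ^ 2 * g ‖z‖), ← integral_const_mul]
  congr 1 with z
  have h : inner ℝ v z = ‖v‖ * (R z) i := by
    rw [← R.inner_map_map, hR, hw, real_inner_smul_left, EuclideanSpace.inner_single_left]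
    simp
  rw [h, R.norm_map]
  ring

theorem norm_sq_mul_eq_sum {d : ℕ} (g : ℝ → ℝ) (z : EuclideanSpace ℝ (Fin d)) :
    ‖z‖ ^ 2 * g ‖z‖ = ∑ i, z i ^ 2 * g ‖z‖ := by
  rw [EuclideanSpace.norm_sq_eq, Finset.sum_mul]
  simp

theorem eventually_integrable_coord_sq_mul {d : ℕ} {g : ℕ → ℝ → ℝ}
    (hmom : ∀ i : Fin d,
      Tendsto (fun k => ∫ z : EuclideanSpace ℝ (Fin d), z i ^ 2 * g k ‖z‖) atTop (𝓝 1)) :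
    ∀ᶠ k in atTop, ∀ i : Fin d,
      Integrable (fun z : EuclideanSpace ℝ (Fin d) => z i ^ 2 * g k ‖z‖) := by
  rw [eventually_all]
  intro i
  filter_upwards [(hmom i).eventually_ne one_ne_zero] with k hk
  exact Integrable.of_integral_ne_zero hk

theorem eventually_integrable_norm_sq_mul {d : ℕ} {g : ℕ → ℝ → ℝ}
    (hmom : ∀ i : Fin d,
      Tendsto (fun k => ∫ z : EuclideanSpace ℝ (Fin d), z i ^ 2 * g k ‖z‖) atTop (𝓝 1)) :
    ∀ᶠ k in atTop,
      Integrable (fun z : EuclideanSpace ℝ (Fin d) => ‖z‖ ^ 2 * g k ‖z‖) := by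
  filter_upwards [eventually_integrable_coord_sq_mul hmom] with k hk
  simp_rw [norm_sq_mul_eq_sum]
  exact integrable_finsetSum _ fun i _ => hk i

theorem tendsto_integral_norm_sq_mul {d : ℕ} {g : ℕ → ℝ → ℝ}
    (hmom : ∀ i : Fin d,
      Tendsto (fun k => ∫ z : EuclideanSpace ℝ (Fin d), z i ^ 2 * g k ‖z‖) atTop (𝓝 1)) :
    Tendsto (fun k => ∫ z : EuclideanSpace ℝ (Fin d), ‖z‖ ^ 2 * g k ‖z‖) atTop (𝓝 d) := by
  have h : Tendsto (fun k => ∑ i, ∫ z : EuclideanSpace ℝ (Fin d), z i ^ 2 * g k ‖z‖) atTop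
      (𝓝 (∑ _i : Fin d, (1 : ℝ))) := tendsto_finsetSum _ fun i _ => hmom i
  simp only [Finset.sum_const, Finset.card_univ, Fintype.card_fin, nsmul_eq_mul, mul_one] at h
  refine h.congr' ?_
  filter_upwards [eventually_integrable_coord_sq_mul hmom] with k hk
  simp_rw [norm_sq_mul_eq_sum]
  rw [integral_finsetSum _ fun i _ => hk i]

/-- If `u` is differentiable at `x` and radial kernels of shrinking support have second moments
tending to `1`, then the nonlocal energy density at `x` converges to `‖∇u(x)‖ ^ 2`. -/
theorem tendsto_integral_sub_sq_mul_radial {d : ℕ} (hd : 1 ≤ d) {g : ℕ → ℝ → ℝ}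
    (hgm : ∀ k, Measurable (g k)) (hg0 : ∀ k t, 0 ≤ g k t) {r : ℕ → ℝ}
    (hr : Tendsto r atTop (𝓝 0)) (hgr : ∀ k t, r k < t → g k t = 0)
    (hmom : ∀ i : Fin d,
      Tendsto (fun k => ∫ z : EuclideanSpace ℝ (Fin d), z i ^ 2 * g k ‖z‖) atTop (𝓝 1))
    {u : EuclideanSpace ℝ (Fin d) → ℝ} (hu : Continuous u) {x : EuclideanSpace ℝ (Fin d)}
    (hx : DifferentiableAt ℝ u x) :
    Tendsto (fun k => ∫ z, (u (x + z) - u x) ^ 2 * g k ‖z‖) atTop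
      (𝓝 (‖fderiv ℝ u x‖ ^ 2)) := by
  set L := fderiv ℝ u x with hL
  have hmain : Tendsto (fun k => ∫ z, L z ^ 2 * g k ‖z‖) atTop (𝓝 (‖L‖ ^ 2)) := by
    set v := (InnerProductSpace.toDual ℝ (EuclideanSpace ℝ (Fin d))).symm L with hv
    have hLv : ∀ z, L z = inner ℝ v z := fun z => by simp [hv]
    have hn : ‖L‖ = ‖v‖ := by simp [hv]
    simp_rw [hLv, integral_inner_sq_mul_radial _ v ⟨0, hd⟩, hn]
    simpa using (hmom ⟨0, hd⟩).const_mul (‖v‖ ^ 2)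
  have hclose : Tendsto (fun k => (∫ z, (u (x + z) - u x) ^ 2 * g k ‖z‖)
      - ∫ z, L z ^ 2 * g k ‖z‖) atTop (𝓝 0) := by
    rw [Metric.tendsto_nhds]
    intro η hη
    obtain ⟨ε, hε, hεη⟩ : ∃ ε > 0, ε * (2 * ‖L‖ + ε) * (d + 1) < η := by
      have hc : Tendsto (fun ε : ℝ => ε * (2 * ‖L‖ + ε) * (d + 1)) (𝓝[>] 0) (𝓝 0) := by
        have : Continuous fun ε : ℝ => ε * (2 * ‖L‖ + ε) * (d + 1) := by fun_prop
        simpa using (this.tendsto 0).mono_left nhdsWithin_le_nhds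
      obtain ⟨ε, h1, h2⟩ := ((hc.eventually_lt_const hη).and self_mem_nhdsWithin).exists
      exact ⟨ε, h2, h1⟩
    have hlin : ∀ᶠ z in 𝓝 (0 : EuclideanSpace ℝ (Fin d)),
        ‖u (x + z) - u x - L z‖ ≤ ε * ‖z‖ :=
      (hasFDerivAt_iff_isLittleO_nhds_zero.1 hx.hasFDerivAt).bound hε
    obtain ⟨ρ, hρ, hball⟩ := Metric.eventually_nhds_iff.1 hlin
    filter_upwards [hr.eventually_lt_const hρ, eventually_integrable_norm_sq_mul hmom,
      (tendsto_integral_norm_sq_mul hmom).eventually_lt_const (lt_add_one (d : ℝ))]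
      with k hk hint hlt
    have hpt : ∀ z, ‖(u (x + z) - u x) ^ 2 * g k ‖z‖ - L z ^ 2 * g k ‖z‖‖
        ≤ ε * (2 * ‖L‖ + ε) * (‖z‖ ^ 2 * g k ‖z‖) := by
      intro z
      by_cases hz : r k < ‖z‖
      · simp [hgr k _ hz]
      have h1 := hball (y := z) (by simpa using (not_lt.1 hz).trans_lt hk)
      have h2 := L.le_opNorm z
      have h3 : |u (x + z) - u x + L z| ≤ (2 * ‖L‖ + ε) * ‖z‖ := by
        rw [Real.norm_eq_abs] at h1 h2
        calc |u (x + z) - u x + L z| = |(u (x + z) - u x - L z) + 2 * L z| := by ring_nf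
          _ ≤ |u (x + z) - u x - L z| + |2 * L z| := abs_add_le _ _
          _ ≤ (2 * ‖L‖ + ε) * ‖z‖ := by
            rw [abs_mul, abs_two]
            linarith
      rw [← sub_mul, sq_sub_sq, norm_mul, norm_mul, Real.norm_of_nonneg (hg0 k _), ← mul_assoc]
      refine mul_le_mul_of_nonneg_right ?_ (hg0 k _)
      calc ‖u (x + z) - u x + L z‖ * ‖u (x + z) - u x - L z‖
          ≤ ((2 * ‖L‖ + ε) * ‖z‖) * (ε * ‖z‖) := by gcongr; exact h3
        _ = ε * (2 * ‖L‖ + ε) * ‖z‖ ^ 2 := by ring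
    have hgmeas : Measurable fun z : EuclideanSpace ℝ (Fin d) => g k ‖z‖ :=
      (hgm k).comp measurable_norm
    have hum : Measurable u := hu.measurable
    have hLint : Integrable fun z => L z ^ 2 * g k ‖z‖ := by
      refine (hint.const_mul (‖L‖ ^ 2)).mono' (by fun_prop) (ae_of_all _ fun z => ?_)
      rw [norm_mul, Real.norm_of_nonneg (hg0 k _), norm_pow, ← mul_assoc, ← mul_pow]
      exact mul_le_mul_of_nonneg_right (by gcongr; exact L.le_opNorm z) (hg0 k _)
    have hdint : Integrable fun z => (u (x + z) - u x) ^ 2 * g k ‖z‖ - L z ^ 2 * g k ‖z‖ :=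
      (hint.const_mul _).mono' (by fun_prop) (ae_of_all _ hpt)
    have huint : Integrable fun z => (u (x + z) - u x) ^ 2 * g k ‖z‖ := by
      exact (hdint.add hLint).congr (ae_of_all _ fun z => sub_add_cancel _ _)
    rw [dist_zero_right, ← integral_sub huint hLint]
    calc _ ≤ ∫ z : EuclideanSpace ℝ (Fin d), ε * (2 * ‖L‖ + ε) * (‖z‖ ^ 2 * g k ‖z‖) :=
          norm_integral_le_of_norm_le (hint.const_mul _) (ae_of_all _ hpt)
      _ = ε * (2 * ‖L‖ + ε) * ∫ z : EuclideanSpace ℝ (Fin d), ‖z‖ ^ 2 * g k ‖z‖ :=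
          integral_const_mul _ _
      _ ≤ ε * (2 * ‖L‖ + ε) * (d + 1) := by gcongr
      _ < η := hεη
  simpa using hclose.add hmain

/-- Localization: a kernel supported in a ball contained in `D` does not see the complement. -/
theorem setIntegral_sub_sq_mul_radial_eq {d : ℕ} {g : ℝ → ℝ} {r : ℝ} (hgr : ∀ t, r < t → g t = 0)
    {D : Set (EuclideanSpace ℝ (Fin d))} {u : EuclideanSpace ℝ (Fin d) → ℝ}
    {x : EuclideanSpace ℝ (Fin d)} (hx : closedBall x r ⊆ D) :
    ∫ y in D, (u y - u x) ^ 2 * g ‖y - x‖ = ∫ z, (u (x + z) - u x) ^ 2 * g ‖z‖ := by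
  rw [setIntegral_eq_integral_of_forall_compl_eq_zero,
    ← integral_add_left_eq_self (fun y => (u y - u x) ^ 2 * g ‖y - x‖) x]
  · simp
  · intro y hy
    rw [hgr, mul_zero]
    by_contra! h
    exact hy (hx (by rwa [mem_closedBall, dist_eq_norm]))

theorem norm_setIntegral_sub_sq_mul_radial_le {d : ℕ} {g : ℝ → ℝ} (hg0 : ∀ t, 0 ≤ g t)
    (hint : Integrable fun z : EuclideanSpace ℝ (Fin d) => ‖z‖ ^ 2 * g ‖z‖)
    (D : Set (EuclideanSpace ℝ (Fin d))) {u : EuclideanSpace ℝ (Fin d) → ℝ} {M : ℝ}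
    (hM : ∀ x y, ‖u y - u x‖ ≤ M * ‖y - x‖) (x : EuclideanSpace ℝ (Fin d)) :
    ‖∫ y in D, (u y - u x) ^ 2 * g ‖y - x‖‖
      ≤ M ^ 2 * ∫ z : EuclideanSpace ℝ (Fin d), ‖z‖ ^ 2 * g ‖z‖ := by
  have hshift : Integrable fun y => M ^ 2 * (‖y - x‖ ^ 2 * g ‖y - x‖) :=
    (hint.comp_sub_right x).const_mul _
  calc _ ≤ ∫ y in D, M ^ 2 * (‖y - x‖ ^ 2 * g ‖y - x‖) := by
        refine norm_integral_le_of_norm_le hshift.integrableOn (ae_of_all _ fun y => ?_)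
        rw [norm_mul, Real.norm_of_nonneg (hg0 _), norm_pow, ← mul_assoc, ← mul_pow]
        exact mul_le_mul_of_nonneg_right (by gcongr; exact hM x y) (hg0 _)
    _ ≤ ∫ y, M ^ 2 * (‖y - x‖ ^ 2 * g ‖y - x‖) :=
        setIntegral_le_integral hshift (ae_of_all _ fun y => by have := hg0 ‖y - x‖; positivity)
    _ = M ^ 2 * ∫ z : EuclideanSpace ℝ (Fin d), ‖z‖ ^ 2 * g ‖z‖ := by
        rw [integral_const_mul,
          integral_sub_right_eq_self (fun z : EuclideanSpace ℝ (Fin d) => ‖z‖ ^ 2 * g ‖z‖) x]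

/-- Bourgain–Brezis–Mironescu-type limit for kernels truncated to balls of radii
`r_k ≤ δ_k` whose truncated second moments still tend to `1`:
`∫_D ∫_D |u(y) − u(x)|² γ̃_{δ_k}(‖y − x‖) 1_{‖y−x‖ ≤ r_k} dy dx → ∫_D ‖∇u‖²`. -/
theorem bbm_limit_truncated
    (d : ℕ) (hd : 1 ≤ d) (γ : ℝ → ℝ) (hγm : Measurable γ) (hγnn : ∀ t, 0 ≤ γ t)
    (hγsupp : ∀ t, 1 ≤ t → γ t = 0)
    (hγnorm : ∀ i : Fin d,
      ∫ ξ in closedBall (0 : EuclideanSpace ℝ (Fin d)) 1, (ξ i) ^ 2 * γ ‖ξ‖ = 1)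
    (D : Set (EuclideanSpace ℝ (Fin d))) (hDo : IsOpen D) (hDb : Bornology.IsBounded D)
    (δ : ℕ → ℝ) (hδpos : ∀ k, 0 < δ k) (hδ0 : Tendsto δ atTop (nhds 0))
    (r : ℕ → ℝ) (hrk : ∀ k, r k ∈ Set.Ioc (0:ℝ) (δ k))
    (hmom : ∀ i : Fin d,
      Tendsto (fun k =>
          ∫ z in closedBall (0 : EuclideanSpace ℝ (Fin d)) (r k),
            (z i) ^ 2 * ((δ k ^ (d + 2))⁻¹ * γ (‖z‖ / δ k)))
        atTop (nhds 1))
    (u : EuclideanSpace ℝ (Fin d) → ℝ) (hu : ContDiff ℝ 2 u)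
    (M : ℝ) (hM : ∀ x, ‖fderiv ℝ u x‖ ≤ M ∧ ‖iteratedFDeriv ℝ 2 u x‖ ≤ M) :
    Tendsto (fun k =>
        ∫ x in D, ∫ y in D, (u y - u x) ^ 2 *
          ((δ k ^ (d + 2))⁻¹ * γ (‖y - x‖ / δ k)) * (closedBall x (r k)).indicator 1 y)
      atTop (nhds (∫ x in D, ‖fderiv ℝ u x‖ ^ 2)) := by
  set g : ℕ → ℝ → ℝ := fun k =>
    (Iic (r k)).indicator fun t => (δ k ^ (d + 2))⁻¹ * γ (t / δ k) with hg
  have hgm : ∀ k, Measurable (g k) := fun k =>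
    Measurable.indicator (by fun_prop) measurableSet_Iic
  have hg0 : ∀ k t, 0 ≤ g k t := fun k t => by
    refine indicator_nonneg (fun t _ => ?_) t
    have := hγnn (t / δ k)
    have := hδpos k
    positivity
  have hgr : ∀ k t, r k < t → g k t = 0 := fun k t ht =>
    indicator_of_notMem (by simpa using ht) _
  have hr0 : Tendsto r atTop (𝓝 0) :=
    squeeze_zero (fun k => (hrk k).1.le) (fun k => (hrk k).2) hδ0
  have hgmom : ∀ i : Fin d,
      Tendsto (fun k => ∫ z : EuclideanSpace ℝ (Fin d), z i ^ 2 * g k ‖z‖) atTop (𝓝 1) := by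
    intro i
    refine (hmom i).congr fun k => ?_
    rw [← integral_indicator measurableSet_closedBall]
    congr 1 with z
    by_cases hz : ‖z‖ ≤ r k <;> simp [hg, indicator, hz]
  have hkernel : ∀ k x y, (u y - u x) ^ 2 * ((δ k ^ (d + 2))⁻¹ * γ (‖y - x‖ / δ k)) *
      (closedBall x (r k)).indicator 1 y = (u y - u x) ^ 2 * g k ‖y - x‖ := by
    intro k x y
    by_cases hz : ‖y - x‖ ≤ r k <;> simp [hg, indicator, dist_eq_norm, hz]
  simp_rw [hkernel]
  have hdiff : Differentiable ℝ u := hu.differentiable two_ne_zero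
  have hum : Measurable u := hu.continuous.measurable
  have hLip : ∀ x y, ‖u y - u x‖ ≤ M * ‖y - x‖ := fun x y =>
    convex_univ.norm_image_sub_le_of_norm_fderiv_le (fun z _ => hdiff z) (fun z _ => (hM z).1)
      (mem_univ x) (mem_univ y)
  refine tendsto_integral_filter_of_dominated_convergence (fun _ => M ^ 2 * (d + 1))
    (Eventually.of_forall fun k => ?_) ?_ ?_ ?_
  · have hmeas : Measurable fun p : EuclideanSpace ℝ (Fin d) × EuclideanSpace ℝ (Fin d) =>
        (u p.2 - u p.1) ^ 2 * g k ‖p.2 - p.1‖ := by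
      have := hgm k
      fun_prop
    exact (hmeas.stronglyMeasurable.integral_prod_right).aestronglyMeasurable
  · filter_upwards [eventually_integrable_norm_sq_mul hgmom,
      (tendsto_integral_norm_sq_mul hgmom).eventually_lt_const (lt_add_one (d : ℝ))]
      with k hint hlt
    refine ae_of_all _ fun x =>
      (norm_setIntegral_sub_sq_mul_radial_le (hg0 k) hint D hLip x).trans ?_
    gcongr
  · have := hDb.measure_lt_top (μ := volume)
    exact integrableOn_const this.ne
  · filter_upwards [ae_restrict_mem hDo.measurableSet] with x hx
    refine (tendsto_integral_sub_sq_mul_radial hd hgm hg0 hr0 hgr hgmom hu.continuous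
      (hdiff x)).congr' ?_
    obtain ⟨ρ, hρ, hsub⟩ := Metric.isOpen_iff.1 hDo x hx
    filter_upwards [hr0.eventually_lt_const hρ] with k hk
    exact (setIntegral_sub_sq_mul_radial_eq (hgr k)
      ((closedBall_subset_ball hk).trans hsub)).symm

end
end

section
/- Let d ≥ 1, let γ : [0,∞) → [0,∞) be measurable with γ(t) = 0 for t ≥ 1 and ∫_{B_1(0)} ξ_i² γ(‖ξ‖) dξ = 1 for every i = 1,…,d, and set γ̃_δ(r) = δ^{-(d+2)} γ(r/δ). Let D ⊂ ℝ^d be a bounded open set and δ_k → 0. For each k and each x ∈ ℝ^d let A_k(x) be a Borel set with {(x,y) : y ∈ A_k(x)} Borel and B_{r_k}(x) ⊆ A_k(x) ⊆ B_{δ_k}(x), where r_k ∈ (0,δ_k] satisfies lim_{k→∞} ∫_{‖z‖ ≤ r_k} z_i² γ̃_{δ_k}(‖z‖) dz = 1 for every i = 1,…,d; define γ_k(x,y) = ½ γ̃_{δ_k}(‖y−x‖)(1_{A_k(x)}(y) + 1_{A_k(y)}(x)). Let u : ℝ^d → ℝ be twice continuously differentiable with bounded first and second derivatives. Then lim_{k→∞}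 ∫_D ∫_D |u(y) − u(x)|² γ_k(x,y) dy dx = ∫_D ‖∇u(x)‖² dx. -/
open MeasureTheory Metric Filter Set Real
open scoped Topology
noncomputable section

theorem integral_coord_mul_coord_radial {d : ℕ} (h : ℝ → ℝ) {i j : Fin d} (hij : i ≠ j) :
    ∫ z : EuclideanSpace ℝ (Fin d), z i * z j * h ‖z‖ = 0 := by
  let e : EuclideanSpace ℝ (Fin d) ≃ₗᵢ[ℝ] EuclideanSpace ℝ (Fin d) :=
    LinearIsometryEquiv.piLpCongrRight 2
      (fun l => if l = i then LinearIsometryEquiv.neg ℝ else LinearIsometryEquiv.refl ℝ ℝ)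
  have key := e.measurePreserving.integral_comp' (f := e.toMeasurableEquiv)
    (fun z : EuclideanSpace ℝ (Fin d) => z i * z j * h ‖z‖)
  have hneg : ∀ z, (e z) i * (e z) j * h ‖e z‖ = -(z i * z j * h ‖z‖) := by
    intro z
    rw [e.norm_map]
    simp [e, hij.symm]
  have : ∫ z : EuclideanSpace ℝ (Fin d), (e z) i * (e z) j * h ‖e z‖ =
    ∫ z : EuclideanSpace ℝ (Fin d), z i * z j * h ‖z‖ := key
  simp only [hneg, integral_neg] at this
  linarith

theorem integral_clm_sq_radial {d : ℕ} {h : ℝ → ℝ} (hm : Measurable h)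
    (hint : ∀ i, Integrable fun z : EuclideanSpace ℝ (Fin d) => z i ^ 2 * h ‖z‖)
    (hone : ∀ i, ∫ z : EuclideanSpace ℝ (Fin d), z i ^ 2 * h ‖z‖ = 1)
    (L : EuclideanSpace ℝ (Fin d) →L[ℝ] ℝ) :
    ∫ z, L z ^ 2 * h ‖z‖ = ‖L‖ ^ 2 := by
  obtain ⟨a, rfl⟩ := (InnerProductSpace.toDual ℝ _).surjective L
  have hcross : ∀ i j, Integrable fun z : EuclideanSpace ℝ (Fin d) => z i * z j * h ‖z‖ := by
    intro i j
    refine ((hint i).norm.add (hint j).norm).mono' ?_ (ae_of_all _ fun z => ?_)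
    · exact Measurable.aestronglyMeasurable (by fun_prop)
    · simp only [norm_mul, norm_pow, Real.norm_eq_abs, Pi.add_apply]
      rw [← add_mul]
      gcongr
      nlinarith [sq_nonneg (|z i| - |z j|), sq_nonneg (|z i|), sq_nonneg (|z j|)]
  have hexp : ∀ z : EuclideanSpace ℝ (Fin d),
      (InnerProductSpace.toDual ℝ _ a) z ^ 2 * h ‖z‖ =
        ∑ i, ∑ j, a i * a j * (z i * z j * h ‖z‖) := by
    intro z
    rw [InnerProductSpace.toDual_apply_apply, PiLp.inner_apply, sq, Finset.sum_mul_sum,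
      Finset.sum_mul]
    refine Finset.sum_congr rfl fun i _ => ?_
    rw [Finset.sum_mul]
    refine Finset.sum_congr rfl fun j _ => ?_
    simp only [RCLike.inner_apply, conj_trivial]
    ring
  simp_rw [hexp]
  rw [integral_finsetSum _ fun i _ => integrable_finsetSum _ fun j _ => (hcross i j).const_mul _,
    LinearIsometryEquiv.norm_map, EuclideanSpace.real_norm_sq_eq]
  refine Finset.sum_congr rfl fun i _ => ?_
  rw [integral_finsetSum _ fun j _ => (hcross i j).const_mul _, Finset.sum_eq_single i]
  · rw [integral_const_mul]
    simp_rw [← sq]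
    rw [hone, mul_one]
  · intro j _ hj
    rw [integral_const_mul, integral_coord_mul_coord_radial h hj.symm, mul_zero]
  · simp

theorem integrable_and_integral_norm_sq_radial {d : ℕ} {h : ℝ → ℝ}
    (hint : ∀ i, Integrable fun z : EuclideanSpace ℝ (Fin d) => z i ^ 2 * h ‖z‖)
    (hone : ∀ i, ∫ z : EuclideanSpace ℝ (Fin d), z i ^ 2 * h ‖z‖ = 1) :
    Integrable (fun z : EuclideanSpace ℝ (Fin d) => ‖z‖ ^ 2 * h ‖z‖) ∧
      ∫ z : EuclideanSpace ℝ (Fin d), ‖z‖ ^ 2 * h ‖z‖ = d := by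
  have hnorm : (fun z : EuclideanSpace ℝ (Fin d) => ‖z‖ ^ 2 * h ‖z‖) =
      fun z => ∑ i, z i ^ 2 * h ‖z‖ := by
    funext z
    rw [EuclideanSpace.real_norm_sq_eq, Finset.sum_mul]
  rw [hnorm, integral_finsetSum _ fun i _ => hint i]
  exact ⟨integrable_finsetSum _ fun i _ => hint i, by simp [hone]⟩

/-- The second moments of `γ̃_δ` are those of `γ`. -/
theorem integrable_and_integral_rescaled {d : ℕ} {γ : ℝ → ℝ}
    (hγsupp : ∀ t, 1 ≤ t → γ t = 0) (i : Fin d)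
    (hγnorm : ∫ ξ in closedBall (0 : EuclideanSpace ℝ (Fin d)) 1, (ξ i) ^ 2 * γ ‖ξ‖ = 1)
    {δ : ℝ} (hδ : 0 < δ) :
    Integrable (fun z : EuclideanSpace ℝ (Fin d) =>
        (z i) ^ 2 * ((δ ^ (d + 2))⁻¹ * γ (‖z‖ / δ))) ∧
      ∫ z : EuclideanSpace ℝ (Fin d), (z i) ^ 2 * ((δ ^ (d + 2))⁻¹ * γ (‖z‖ / δ)) = 1 := by
  set f : EuclideanSpace ℝ (Fin d) → ℝ := fun ξ => (ξ i) ^ 2 * γ ‖ξ‖ with hf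
  have hzero : ∀ ξ, ξ ∉ closedBall (0 : EuclideanSpace ℝ (Fin d)) 1 → f ξ = 0 := by
    intro ξ hξ
    rw [mem_closedBall_zero_iff, not_le] at hξ
    simp [hf, hγsupp _ hξ.le]
  have hfint : ∫ ξ, f ξ = 1 := by
    rw [← setIntegral_eq_integral_of_forall_compl_eq_zero hzero, hγnorm]
  have hfi : Integrable f := .of_integral_ne_zero (by rw [hfint]; exact one_ne_zero)
  have hscale : (fun z : EuclideanSpace ℝ (Fin d) =>
      (z i) ^ 2 * ((δ ^ (d + 2))⁻¹ * γ (‖z‖ / δ))) = fun z => (δ ^ d)⁻¹ * f (δ⁻¹ • z) := by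
    funext z
    simp only [hf, norm_smul, norm_inv, Real.norm_eq_abs, abs_of_pos hδ, PiLp.smul_apply,
      smul_eq_mul]
    rw [div_eq_inv_mul]
    field_simp
    ring
  rw [hscale]
  refine ⟨(hfi.comp_smul (inv_ne_zero hδ.ne')).const_mul _, ?_⟩
  rw [integral_const_mul, Measure.integral_comp_smul, hfint, finrank_euclideanSpace_fin]
  rw [abs_of_pos (by positivity), inv_pow, inv_inv, smul_eq_mul, mul_one]
  exact inv_mul_cancel₀ (by positivity)


theorem sq_mul_le_of_abs_le {a M t g w : ℝ} (ha : |a| ≤ M * t) (hg : 0 ≤ g) (hgw : g ≤ w) :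
    a ^ 2 * g ≤ M ^ 2 * (t ^ 2 * w) := by
  rw [← mul_assoc, ← mul_pow, ← sq_abs a]
  exact mul_le_mul (pow_le_pow_left₀ (abs_nonneg _) ha 2) hgw hg (sq_nonneg _)

/-- Localization at a point of differentiability: kernels `g k` squeezed between the truncation to
`‖y - x‖ ≤ r k` of a radial kernel and the radial kernel itself produce `‖L‖ ^ 2` in the limit. -/
theorem tendsto_integral_sq_increment {d : ℕ} {D : Set (EuclideanSpace ℝ (Fin d))}
    (hDo : IsOpen D) {x : EuclideanSpace ℝ (Fin d)} (hx : x ∈ D)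
    {u : EuclideanSpace ℝ (Fin d) → ℝ} (hum : Measurable u)
    {L : EuclideanSpace ℝ (Fin d) →L[ℝ] ℝ} (hL : HasFDerivAt u L x) {M : ℝ} (hLM : ‖L‖ ≤ M)
    (hlip : ∀ y, |u y - u x| ≤ M * ‖y - x‖)
    {δ r : ℕ → ℝ} (hδ0 : Tendsto δ atTop (𝓝 0))
    {h : ℕ → ℝ → ℝ} (hm : ∀ k, Measurable (h k)) (hnn : ∀ k t, 0 ≤ h k t)
    (hsupp : ∀ k t, δ k ≤ t → h k t = 0)
    (hint : ∀ k i, Integrable fun z : EuclideanSpace ℝ (Fin d) => z i ^ 2 * h k ‖z‖)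
    (hone : ∀ k i, ∫ z : EuclideanSpace ℝ (Fin d), z i ^ 2 * h k ‖z‖ = 1)
    (hmom : ∀ i, Tendsto
      (fun k => ∫ z in closedBall (0 : EuclideanSpace ℝ (Fin d)) (r k), z i ^ 2 * h k ‖z‖)
      atTop (𝓝 1))
    {g : ℕ → EuclideanSpace ℝ (Fin d) → ℝ} (hgm : ∀ k, Measurable (g k))
    (hg0 : ∀ k y, 0 ≤ g k y) (hg1 : ∀ k y, g k y ≤ h k ‖y - x‖)
    (hgr : ∀ k y, ‖y - x‖ ≤ r k → g k y = h k ‖y - x‖) :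
    Tendsto (fun k => ∫ y in D, (u y - u x) ^ 2 * g k y) atTop (𝓝 (‖L‖ ^ 2)) := by
  have hM : 0 ≤ M := (norm_nonneg L).trans hLM
  have hI := fun k => (integrable_and_integral_norm_sq_radial (hint k) (hone k)).1
  have hIone := fun k => (integrable_and_integral_norm_sq_radial (hint k) (hone k)).2
  have hIr : ∀ k, ∫ z in closedBall (0 : EuclideanSpace ℝ (Fin d)) (r k), ‖z‖ ^ 2 * h k ‖z‖ =
      ∑ i, ∫ z in closedBall (0 : EuclideanSpace ℝ (Fin d)) (r k), z i ^ 2 * h k ‖z‖ :=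
    fun k => by
      rw [← integral_finsetSum _ fun i _ => (hint k i).integrableOn]
      simp_rw [EuclideanSpace.real_norm_sq_eq, Finset.sum_mul]
  have hIlim : Tendsto (fun k => M ^ 2 * (d -
      ∫ z in closedBall (0 : EuclideanSpace ℝ (Fin d)) (r k), ‖z‖ ^ 2 * h k ‖z‖))
      atTop (𝓝 0) := by
    simp_rw [hIr]
    have := ((tendsto_finsetSum Finset.univ fun i _ => hmom i).const_sub (d : ℝ)).const_mul (M ^ 2)
    simpa using this
  -- translated integrand
  set F : ℕ → EuclideanSpace ℝ (Fin d) → ℝ := fun k z =>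
    D.indicator (fun y => (u y - u x) ^ 2 * g k y) (z + x) with hF
  have hFint : ∀ k, ∫ y in D, (u y - u x) ^ 2 * g k y = ∫ z, F k z := fun k => by
    rw [← integral_indicator hDo.measurableSet, ← integral_add_right_eq_self _ x]
  have hFle : ∀ k y, (u y - u x) ^ 2 * g k y ≤ M ^ 2 * (‖y - x‖ ^ 2 * h k ‖y - x‖) :=
    fun k y => sq_mul_le_of_abs_le (hlip y) (hg0 k y) (hg1 k y)
  have hFI : ∀ k, Integrable (F k) := fun k => by
    refine ((hI k).const_mul (M ^ 2)).mono' ?_ (ae_of_all _ fun z => ?_)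
    · have hm' : Measurable fun y => (u y - u x) ^ 2 * g k y := by
        have := hgm k
        fun_prop
      exact ((hm'.indicator hDo.measurableSet).comp
        (measurable_id.add_const x)).aestronglyMeasurable
    · refine (norm_indicator_le_norm_self _ _).trans ?_
      rw [Real.norm_of_nonneg (mul_nonneg (sq_nonneg _) (hg0 k _))]
      simpa using hFle k (z + x)
  have hLI : ∀ k, Integrable fun z => L z ^ 2 * h k ‖z‖ := fun k => by
    refine ((hI k).const_mul (M ^ 2)).mono' ?_ (ae_of_all _ fun z => ?_)
    · have := hm k
      exact Measurable.aestronglyMeasurable (by fun_prop)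
    · rw [Real.norm_of_nonneg (mul_nonneg (sq_nonneg _) (hnn k _))]
      exact sq_mul_le_of_abs_le (L.le_of_opNorm_le hLM z) (hnn k _) le_rfl
  have hbound : ∀ c > 0, ∀ᶠ k in atTop, |(∫ y in D, (u y - u x) ^ 2 * g k y) - ‖L‖ ^ 2| ≤
      2 * M * c * d + M ^ 2 * (d -
        ∫ z in closedBall (0 : EuclideanSpace ℝ (Fin d)) (r k), ‖z‖ ^ 2 * h k ‖z‖) := by
    intro c hc
    have hnear := (hL.isLittleO.def hc).and (hDo.mem_nhds hx)
    obtain ⟨ρ, hρ, hball⟩ := Metric.eventually_nhds_iff.1 hnear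
    filter_upwards [hδ0.eventually_lt_const hρ] with k hk
    rw [hFint, ← integral_clm_sq_radial (hm k) (hint k) (hone k) L,
      ← integral_sub (hFI k) (hLI k), ← Real.norm_eq_abs]
    have hind := (hI k).indicator (measurableSet_closedBall (x := 0) (ε := r k))
    refine (norm_integral_le_of_norm_le
      (((hI k).const_mul (2 * M * c)).add (((hI k).sub hind).const_mul (M ^ 2)))
      (ae_of_all _ fun z => ?_)).trans_eq ?_
    · simp only [Pi.add_apply, Pi.sub_apply]
      have hh := hnn k ‖z‖
      by_cases hz : δ k ≤ ‖z‖
      · have h0 : h k ‖z‖ = 0 := hsupp k _ hz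
        have hg : g k (z + x) = 0 :=
          le_antisymm (by simpa [h0] using hg1 k (z + x)) (hg0 k _)
        have hF0 : F k z = 0 := indicator_apply_eq_zero.2 fun _ => by rw [hg, mul_zero]
        have hi0 : (closedBall 0 (r k)).indicator
            (fun z : EuclideanSpace ℝ (Fin d) => ‖z‖ ^ 2 * h k ‖z‖) z = 0 :=
          indicator_apply_eq_zero.2 fun _ => by rw [h0, mul_zero]
        simp [hF0, hi0, h0]
      · obtain ⟨hdiff, hzD⟩ := hball (y := z + x) (by simpa using (not_le.1 hz).trans hk)
        have hFz : F k z = (u (z + x) - u x) ^ 2 * g k (z + x) := indicator_of_mem hzD _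
        rw [hFz]
        have ha := hlip (z + x)
        have hb := L.le_of_opNorm_le hLM z
        have hg1z := hg1 k (z + x)
        have hg0z := hg0 k (z + x)
        have hgrz := hgr k (z + x)
        simp only [add_sub_cancel_right, Real.norm_eq_abs] at hdiff ha hb hg1z hgrz
        generalize u (z + x) - u x = a at *
        generalize L z = b at *
        generalize g k (z + x) = G at *
        have hsq : |a ^ 2 - b ^ 2| ≤ 2 * M * c * ‖z‖ ^ 2 := by
          have : a ^ 2 - b ^ 2 = (a - b) * (a + b) := by ring
          rw [this, abs_mul]
          calc |a - b| * |a + b| ≤ (c * ‖z‖) * (M * ‖z‖ + M * ‖z‖) := by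
                gcongr
                exact (abs_add_le a b).trans (add_le_add ha hb)
            _ = _ := by ring
        have hasq : a ^ 2 ≤ M ^ 2 * ‖z‖ ^ 2 := by
          rw [← sq_abs, ← mul_pow]
          gcongr
        have hdefect : ‖z‖ ^ 2 * (h k ‖z‖ - G) ≤ ‖z‖ ^ 2 * h k ‖z‖ -
            (closedBall 0 (r k)).indicator
              (fun z : EuclideanSpace ℝ (Fin d) => ‖z‖ ^ 2 * h k ‖z‖) z := by
          by_cases hzr : ‖z‖ ≤ r k
          · rw [indicator_of_mem (by simpa using hzr), hgrz hzr]
            simp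
          · rw [indicator_of_notMem (by simpa using hzr), sub_zero]
            gcongr
            linarith
        have hsplit : a ^ 2 * G - b ^ 2 * h k ‖z‖ =
            (a ^ 2 - b ^ 2) * h k ‖z‖ - a ^ 2 * (h k ‖z‖ - G) := by ring
        rw [hsplit]
        refine (norm_sub_le _ _).trans (add_le_add ?_ ?_)
        · rw [norm_mul, Real.norm_eq_abs, Real.norm_of_nonneg hh, ← mul_assoc]
          gcongr
        · rw [Real.norm_of_nonneg (mul_nonneg (sq_nonneg _) (sub_nonneg.2 hg1z))]
          calc a ^ 2 * (h k ‖z‖ - G) ≤ M ^ 2 * ‖z‖ ^ 2 * (h k ‖z‖ - G) :=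
                mul_le_mul_of_nonneg_right hasq (sub_nonneg.2 hg1z)
            _ = M ^ 2 * (‖z‖ ^ 2 * (h k ‖z‖ - G)) := mul_assoc _ _ _
            _ ≤ _ := by gcongr
    · rw [integral_add' ((hI k).const_mul _) (((hI k).sub hind).const_mul _),
        integral_const_mul, integral_const_mul, integral_sub' (hI k) hind, hIone,
        integral_indicator measurableSet_closedBall]
  rw [Metric.tendsto_nhds]
  intro ε hε
  have hc : 0 < ε / (2 * (2 * M * d + 1)) := by positivity
  filter_upwards [hbound _ hc, hIlim.eventually_lt_const (half_pos hε)] with k hk hk'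
  rw [Real.dist_eq]
  refine hk.trans_lt ?_
  have : 2 * M * (ε / (2 * (2 * M * d + 1))) * d ≤ ε / 2 := by
    rw [show 2 * M * (ε / (2 * (2 * M * d + 1))) * d =
      (ε / 2) * ((2 * M * d) / (2 * M * d + 1)) by field_simp]
    refine mul_le_of_le_one_right (half_pos hε).le ((div_le_one (by positivity)).2 ?_)
    linarith
  linarith

/-- Bourgain–Brezis–Mironescu-type limit for the symmetrized approximate kernels
`γ_k(x,y) = ½ γ̃_{δ_k}(‖y−x‖)(1_{A_k(x)}(y) + 1_{A_k(y)}(x))`, where the approximating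
sets satisfy `B_{r_k}(x) ⊆ A_k(x) ⊆ B_{δ_k}(x)` and the truncated second moments tend
to `1`:  `∫_D ∫_D |u(y) − u(x)|² γ_k(x,y) dy dx → ∫_D ‖∇u‖²`. -/
theorem bbm_limit_symmetrized
    (d : ℕ) (hd : 1 ≤ d) (γ : ℝ → ℝ) (hγm : Measurable γ) (hγnn : ∀ t, 0 ≤ γ t)
    (hγsupp : ∀ t, 1 ≤ t → γ t = 0)
    (hγnorm : ∀ i : Fin d,
      ∫ ξ in closedBall (0 : EuclideanSpace ℝ (Fin d)) 1, (ξ i) ^ 2 * γ ‖ξ‖ = 1)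
    (D : Set (EuclideanSpace ℝ (Fin d))) (hDo : IsOpen D) (hDb : Bornology.IsBounded D)
    (δ : ℕ → ℝ) (hδpos : ∀ k, 0 < δ k) (hδ0 : Tendsto δ atTop (nhds 0))
    (r : ℕ → ℝ) (hrk : ∀ k, r k ∈ Set.Ioc (0:ℝ) (δ k))
    (A : ℕ → EuclideanSpace ℝ (Fin d) → Set (EuclideanSpace ℝ (Fin d)))
    (hAmeas : ∀ k, MeasurableSet
      {p : EuclideanSpace ℝ (Fin d) × EuclideanSpace ℝ (Fin d) | p.2 ∈ A k p.1})
    (hA1 : ∀ k x, closedBall x (r k) ⊆ A k x)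
    (hA2 : ∀ k x, A k x ⊆ closedBall x (δ k))
    (hmom : ∀ i : Fin d,
      Tendsto (fun k =>
          ∫ z in closedBall (0 : EuclideanSpace ℝ (Fin d)) (r k),
            (z i) ^ 2 * ((δ k ^ (d + 2))⁻¹ * γ (‖z‖ / δ k)))
        atTop (nhds 1))
    (u : EuclideanSpace ℝ (Fin d) → ℝ) (hu : ContDiff ℝ 2 u)
    (M : ℝ) (hM : ∀ x, ‖fderiv ℝ u x‖ ≤ M ∧ ‖iteratedFDeriv ℝ 2 u x‖ ≤ M) :
    Tendsto (fun k =>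
        ∫ x in D, ∫ y in D, (u y - u x) ^ 2 *
          ((1 / 2) * ((δ k ^ (d + 2))⁻¹ * γ (‖y - x‖ / δ k)) *
            ((A k x).indicator 1 y + (A k y).indicator 1 x)))
      atTop (nhds (∫ x in D, ‖fderiv ℝ u x‖ ^ 2)) := by
  set h : ℕ → ℝ → ℝ := fun k t => (δ k ^ (d + 2))⁻¹ * γ (t / δ k) with hh
  have hm : ∀ k, Measurable (h k) := fun k => by fun_prop
  have hnn : ∀ k t, 0 ≤ h k t := fun k t =>
    mul_nonneg (inv_nonneg.2 (pow_nonneg (hδpos k).le _)) (hγnn _)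
  have hsupp : ∀ k t, δ k ≤ t → h k t = 0 := fun k t ht => by
    simp [hh, hγsupp _ ((one_le_div (hδpos k)).2 ht)]
  have hint : ∀ k i, Integrable fun z : EuclideanSpace ℝ (Fin d) => z i ^ 2 * h k ‖z‖ :=
    fun k i => (integrable_and_integral_rescaled hγsupp i (hγnorm i) (hδpos k)).1
  have hone : ∀ k i, ∫ z : EuclideanSpace ℝ (Fin d), z i ^ 2 * h k ‖z‖ = 1 :=
    fun k i => (integrable_and_integral_rescaled hγsupp i (hγnorm i) (hδpos k)).2
  have hdiff : Differentiable ℝ u := hu.differentiable (by norm_num)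
  have hum : Measurable u := hu.continuous.measurable
  have hlip : ∀ x y, |u y - u x| ≤ M * ‖y - x‖ := fun x y =>
    convex_univ.norm_image_sub_le_of_norm_fderiv_le (fun z _ => hdiff z) (fun z _ => (hM z).1)
      (mem_univ x) (mem_univ y)
  set G : ℕ → EuclideanSpace ℝ (Fin d) → EuclideanSpace ℝ (Fin d) → ℝ := fun k x y =>
    (1 / 2) * h k ‖y - x‖ * ((A k x).indicator 1 y + (A k y).indicator 1 x) with hG
  have hGm : ∀ k, Measurable fun p : EuclideanSpace ℝ (Fin d) × EuclideanSpace ℝ (Fin d) =>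
      G k p.1 p.2 := fun k => by
    have h1 : Measurable fun p : EuclideanSpace ℝ (Fin d) × EuclideanSpace ℝ (Fin d) =>
        (A k p.1).indicator (1 : EuclideanSpace ℝ (Fin d) → ℝ) p.2 :=
      (measurable_one (α := ℝ)).indicator (hAmeas k)
    have h2 := h1.comp measurable_swap
    have h3 : Measurable fun p : EuclideanSpace ℝ (Fin d) × EuclideanSpace ℝ (Fin d) =>
        h k ‖p.2 - p.1‖ := (hm k).comp (measurable_snd.sub measurable_fst).norm
    exact (h3.const_mul _).mul (h1.add h2)
  have hind : ∀ (S : Set (EuclideanSpace ℝ (Fin d))) y, 0 ≤ S.indicator (1 : EuclideanSpace ℝ (Fin d) → ℝ) y ∧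
      S.indicator (1 : EuclideanSpace ℝ (Fin d) → ℝ) y ≤ 1 := fun S y =>
    ⟨indicator_nonneg (fun _ _ => zero_le_one) y,
      indicator_le_self' (fun _ _ => zero_le_one) y⟩
  have hG0 : ∀ k x y, 0 ≤ G k x y := fun k x y =>
    mul_nonneg (mul_nonneg (by norm_num) (hnn _ _)) (add_nonneg (hind _ _).1 (hind _ _).1)
  have hG1 : ∀ k x y, G k x y ≤ h k ‖y - x‖ := fun k x y => by
    have h2 : (A k x).indicator (1 : EuclideanSpace ℝ (Fin d) → ℝ) y +
        (A k y).indicator (1 : EuclideanSpace ℝ (Fin d) → ℝ) x ≤ 2 := by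
      linarith [(hind (A k x) y).2, (hind (A k y) x).2]
    calc G k x y ≤ (1 / 2) * h k ‖y - x‖ * 2 :=
          mul_le_mul_of_nonneg_left h2 (mul_nonneg (by norm_num) (hnn _ _))
      _ = h k ‖y - x‖ := by ring
  have hGr : ∀ k x y, ‖y - x‖ ≤ r k → G k x y = h k ‖y - x‖ := fun k x y hxy => by
    have hy : y ∈ A k x := hA1 k x (by rwa [mem_closedBall, dist_eq_norm])
    have hx : x ∈ A k y := hA1 k y (by rwa [mem_closedBall, dist_eq_norm, norm_sub_rev])
    simp only [hG, indicator_of_mem hy, indicator_of_mem hx, Pi.one_apply]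
    ring
  have hI := fun k => integrable_and_integral_norm_sq_radial (hint k) (hone k)
  change Tendsto (fun k => ∫ x in D, ∫ y in D, (u y - u x) ^ 2 * G k x y) atTop _
  clear_value G
  refine tendsto_integral_of_dominated_convergence (fun _ => M ^ 2 * (d : ℝ)) (fun k => ?_)
    (integrableOn_const hDb.measure_lt_top.ne) (fun k => ae_of_all _ fun x => ?_)
    ((ae_restrict_iff' hDo.measurableSet).2 (ae_of_all _ fun x hx => ?_))
  · have hmeas : Measurable fun p : EuclideanSpace ℝ (Fin d) × EuclideanSpace ℝ (Fin d) =>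
        (u p.2 - u p.1) ^ 2 * G k p.1 p.2 :=
      (((hum.comp measurable_snd).sub (hum.comp measurable_fst)).pow_const 2).mul (hGm k)
    exact hmeas.stronglyMeasurable.integral_prod_right'.aestronglyMeasurable
  · have hIx := ((hI k).1.comp_sub_right x).const_mul (M ^ 2)
    calc ‖∫ y in D, (u y - u x) ^ 2 * G k x y‖
        ≤ ∫ y in D, M ^ 2 * (‖y - x‖ ^ 2 * h k ‖y - x‖) := by
          refine norm_integral_le_of_norm_le hIx.integrableOn (ae_of_all _ fun y => ?_)
          rw [Real.norm_of_nonneg (mul_nonneg (sq_nonneg _) (hG0 k x y))]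
          exact sq_mul_le_of_abs_le (hlip x y) (hG0 k x y) (hG1 k x y)
      _ ≤ ∫ y, M ^ 2 * (‖y - x‖ ^ 2 * h k ‖y - x‖) :=
          setIntegral_le_integral hIx (ae_of_all _ fun y =>
            mul_nonneg (sq_nonneg _) (mul_nonneg (sq_nonneg _) (hnn _ _)))
      _ = M ^ 2 * d := by
          rw [integral_const_mul,
            integral_sub_right_eq_self (fun z => ‖z‖ ^ 2 * h k ‖z‖) x, (hI k).2]
  · have hGx : ∀ k, Measurable (G k x) := fun k => (hGm k).comp measurable_prodMk_left
    exact tendsto_integral_sq_increment (g := fun k => G k x) hDo hx hum (hdiff x).hasFDerivAt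
      (hM x).1 (hlip x) hδ0 hm hnn hsupp hint hone hmom hGx (fun k => hG0 k x)
      (fun k => hG1 k x) (fun k => hGr k x)

end
end
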